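/- arXiv:2411.16663 — 2 statements merged into one kernel-verified Lean document; each statement's English description precedes it below -/
import Mathlib

section
/- Let n ≥ 1 and let A be a nonzero irreducible polynomial in n variables over ℂ. For a function u : ℝⁿ → ℂ that is C^∞ on an open set Ω, write A(∂)u for the constant-coefficient differential operator obtained from A by substituting the partial derivative ∂/∂x_i for the i-th variable, i.e. A(∂)u = Σ_{α ∈ supp(A)} (coefficient of x^α in A) · ∂^α u. Suppose Ω ⊆ ℝⁿ is open and convex and u : ℝⁿ → ℂ satisfies: u is C^∞ on Ω and A(∂)u = 0 at every point of Ω. Then for every compact set K ⊆ Ω, every m ∈ ℕ, and every ε > 0, there exist r ∈ ℕ, points z_1, …, z_r ∈ ℂⁿ with A(z_j) = 0 for each j, and coefficients c_1, …, c_r ∈ ℂ, such that the function g(x) = Σ_{j=1}^r c_j · exp(Σ_{i=1}^n x_i z_{j,i}) satisfies: for every k ≤ m, the k-th iterated derivative of u − g (taken within Ω) has norm at most ε at every point of K. -/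
/-- The partial derivative in the `i`-th coordinate direction of a function on `ℝⁿ`. -/
noncomputable def pd {n : ℕ} (i : Fin n) (f : (Fin n → ℝ) → ℂ) : (Fin n → ℝ) → ℂ :=
  fun x => fderiv ℝ f x (Pi.single i 1)

/-- The iterated partial derivative `∂^α f` for a multi-index `α : Fin n →₀ ℕ`. -/
noncomputable def mpd {n : ℕ} (α : Fin n →₀ ℕ) (f : (Fin n → ℝ) → ℂ) : (Fin n → ℝ) → ℂ :=
  (List.finRange n).foldr (fun i g => (pd i)^[α i] g) f

open MeasureTheory Metric Filter Topology
open scoped ContDiff FourierTransform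

theorem differentiableAt_integral_of_dominated {α : Type*} [MeasurableSpace α] {μ : Measure α}
    {f : ℂ → α → ℂ} {s₀ : ℂ} {r : ℝ} (hr : 0 < r) {bound : α → ℝ} (hb : Integrable bound μ)
    (hmeas : ∀ s ∈ ball s₀ r, AEStronglyMeasurable (f s) μ)
    (hdiff : ∀ a, DifferentiableOn ℂ (fun s => f s a) (ball s₀ r))
    (hbound : ∀ s ∈ ball s₀ r, ∀ a, ‖f s a‖ ≤ bound a) :
    DifferentiableAt ℂ (fun s => ∫ a, f s a ∂μ) s₀ := by
  have hs₀ : s₀ ∈ ball s₀ r := mem_ball_self hr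
  have hder : ∀ s ∈ ball s₀ r, ∀ a, HasDerivAt (fun s => f s a) (deriv (fun s => f s a) s) s :=
    fun s hs a => ((hdiff a).differentiableAt (isOpen_ball.mem_nhds hs)).hasDerivAt
  refine (hasDerivAt_integral_of_dominated_loc_of_deriv_le (F := f)
    (F' := fun s a => deriv (fun s => f s a) s) (bound := fun a => bound a / (r / 2))
    (ball_mem_nhds s₀ (half_pos hr)) ?_ ?_ ?_ ?_ (hb.div_const _) ?_).2.differentiableAt
  · filter_upwards [ball_mem_nhds s₀ hr] with s hs using hmeas s hs
  · exact hb.mono' (hmeas s₀ hs₀) (ae_of_all _ fun a => hbound s₀ hs₀ a)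
  · have hstep : ∀ k : ℕ, ‖((r / (k + 2) : ℝ) : ℂ)‖ < r := by
      intro k
      rw [Complex.norm_real, Real.norm_of_nonneg (by positivity)]
      exact div_lt_self hr (by linarith [(Nat.cast_nonneg k : (0 : ℝ) ≤ k)])
    refine aestronglyMeasurable_of_tendsto_ae atTop
      (f := fun (k : ℕ) a => ((r / (k + 2) : ℝ) : ℂ)⁻¹ • (f (s₀ + (r / (k + 2) : ℝ)) a - f s₀ a))
      (fun k => ?_) (ae_of_all _ fun a => ?_)
    · have h : s₀ + ((r / (k + 2) : ℝ) : ℂ) ∈ ball s₀ r := by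
        simpa [mem_ball, dist_eq_norm] using hstep k
      exact AEStronglyMeasurable.const_smul (f := f (s₀ + ((r / (k + 2) : ℝ) : ℂ)) - f s₀)
        ((hmeas _ h).sub (hmeas _ hs₀)) (((r / (k + 2) : ℝ) : ℂ)⁻¹)
    · have h1 := hasDerivAt_iff_tendsto_slope_zero.1 (hder s₀ hs₀ a)
      refine h1.comp (tendsto_nhdsWithin_iff.2 ⟨?_, Eventually.of_forall fun k => ?_⟩)
      · have : Tendsto (fun k : ℕ => r / ((k : ℝ) + 2)) atTop (𝓝 0) :=
          Tendsto.const_div_atTop (tendsto_natCast_atTop_atTop.atTop_add tendsto_const_nhds) r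
        simpa [Function.comp_def] using (Complex.continuous_ofReal.tendsto 0).comp this
      · have : (r / ((k : ℝ) + 2)) ≠ 0 := by positivity
        simpa only [Set.mem_compl_iff, Set.mem_singleton_iff, Complex.ofReal_eq_zero] using this
  · refine ae_of_all _ fun a s hs => ?_
    have hsub : closedBall s (r / 2) ⊆ ball s₀ r := fun w hw => by
      rw [mem_ball] at hs ⊢
      rw [mem_closedBall] at hw
      linarith [dist_triangle w s s₀]
    refine Complex.norm_deriv_le_of_forall_mem_sphere_norm_le (half_pos hr) ?_ fun w hw =>
      hbound w (hsub (sphere_subset_closedBall hw)) a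
    exact ((hdiff a).mono hsub).diffContOnCl_ball subset_rfl
  · refine ae_of_all _ fun a s hs => hder s (ball_subset_ball (by linarith) hs) a

/-- Dividing an entire function by monic linear factors at distinct zeros, with control of the
quotient at the origin by the values on the unit circle. -/
theorem exists_entire_quotient (S : Finset ℂ) (f : ℂ → ℂ) (hf : Differentiable ℂ f)
    (hS : ∀ a ∈ S, f a = 0) :
    ∃ q : ℂ → ℂ, Differentiable ℂ q ∧ (∀ l, f l = (∏ a ∈ S, (l - a)) * q l) := by
  induction S using Finset.induction_on generalizing f with
  | empty => exact ⟨f, hf, by simp⟩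
  | insert a S ha ih =>
    obtain ⟨q, hq, hfq⟩ := ih f hf fun b hb => hS b (Finset.mem_insert_of_mem hb)
    have hqa : q a = 0 := by
      have := hfq a
      rw [hS a (Finset.mem_insert_self _ _), eq_comm, mul_eq_zero, Finset.prod_eq_zero_iff] at this
      rcases this with ⟨b, hb, hab⟩ | h
      · exact absurd (sub_eq_zero.1 hab ▸ hb) ha
      · exact h
    refine ⟨dslope q a, ?_, fun l => ?_⟩
    · rw [← differentiableOn_univ] at hq ⊢
      exact (Complex.differentiableOn_dslope univ_mem).2 hq
    · rw [Finset.prod_insert ha, hfq l]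
      have := sub_smul_dslope q a l
      rw [hqa, sub_zero, smul_eq_mul] at this
      rw [← this]; ring

theorem norm_quotient_zero_le (S : Finset ℂ) (q : ℂ → ℂ) (hq : Differentiable ℂ q) (B : ℝ)
    (hB : ∀ l : ℂ, ‖l‖ = 1 → ‖(∏ a ∈ S, (l - a)) * q l‖ ≤ B) : ‖q 0‖ ≤ B := by
  have h1 : ∀ l a : ℂ, ‖l‖ = 1 → ‖1 - (starRingEnd ℂ) a * l‖ = ‖l - a‖ := by
    intro l a hl
    have hll : (starRingEnd ℂ) l * l = 1 := by
      rw [mul_comm, Complex.mul_conj, Complex.normSq_eq_norm_sq, hl]; simp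
    have : 1 - (starRingEnd ℂ) a * l = (starRingEnd ℂ) (l - a) * l := by
      rw [map_sub, sub_mul, hll]
    rw [this, norm_mul, hl, mul_one, RCLike.norm_conj]
  have h2 : Differentiable ℂ fun l => (∏ a ∈ S, (1 - (starRingEnd ℂ) a * l)) * q l := by
    fun_prop
  have h3 := Complex.norm_le_of_forall_mem_frontier_norm_le (U := ball (0 : ℂ) 1) (C := B)
    isBounded_ball h2.diffContOnCl (z := 0) (fun l hl => ?_) (subset_closure (by simp))
  · simpa using h3
  · rw [frontier_ball _ one_ne_zero, mem_sphere_zero_iff_norm] at hl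
    refine le_trans (le_of_eq ?_) (hB l hl)
    rw [norm_mul, norm_mul, norm_prod, norm_prod]
    congr 1
    exact Finset.prod_congr rfl fun a _ => h1 l a hl

section LineRestriction

open Polynomial

/-- The restriction of a polynomial to a generic line in the direction `θ`. -/
noncomputable def linePoly {n : ℕ} (θ : Fin n → ℂ) : MvPolynomial (Fin n) ℂ →ₐ[ℂ]
    (MvPolynomial (Fin n) ℂ)[X] :=
  MvPolynomial.aeval fun i => C (MvPolynomial.X i) + C (MvPolynomial.C (θ i)) * X

theorem eval_linePoly {n : ℕ} (θ z : Fin n → ℂ) (l : ℂ) (A : MvPolynomial (Fin n) ℂ) :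
    ((linePoly θ A).map (MvPolynomial.eval z)).eval l = MvPolynomial.eval (z + l • θ) A := by
  have h : ((evalRingHom l).comp (mapRingHom (MvPolynomial.eval z))).comp
      (linePoly θ).toRingHom = MvPolynomial.eval (z + l • θ) := by
    apply MvPolynomial.ringHom_ext
    · intro r
      simp [linePoly, IsScalarTower.algebraMap_apply ℂ (MvPolynomial (Fin n) ℂ)
        (MvPolynomial (Fin n) ℂ)[X], MvPolynomial.algebraMap_eq]
    · intro i
      simp [linePoly, mul_comm l]
  simpa using congrArg (fun g => g A) h

/-- The shear `z ↦ z + X θ` of the polynomial ring. -/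
noncomputable def shear {n : ℕ} (θ : Fin n → ℂ) : (MvPolynomial (Fin n) ℂ)[X] →+*
    (MvPolynomial (Fin n) ℂ)[X] :=
  eval₂RingHom (linePoly θ).toRingHom X

theorem shear_comp_shear {n : ℕ} (θ : Fin n → ℂ) :
    (shear (-θ)).comp (shear θ) = RingHom.id _ := by
  apply Polynomial.ringHom_ext'
  · apply MvPolynomial.ringHom_ext
    · intro r
      simp [shear, linePoly, IsScalarTower.algebraMap_apply ℂ (MvPolynomial (Fin n) ℂ)
        (MvPolynomial (Fin n) ℂ)[X], MvPolynomial.algebraMap_eq]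
    · intro i
      simp [shear, linePoly, IsScalarTower.algebraMap_apply ℂ (MvPolynomial (Fin n) ℂ)
        (MvPolynomial (Fin n) ℂ)[X], MvPolynomial.algebraMap_eq]
      ring
  · simp [shear]

noncomputable def shearEquiv {n : ℕ} (θ : Fin n → ℂ) : (MvPolynomial (Fin n) ℂ)[X] ≃+*
    (MvPolynomial (Fin n) ℂ)[X] :=
  RingEquiv.ofRingHom (shear θ) (shear (-θ))
    (by simpa using shear_comp_shear (-θ)) (shear_comp_shear θ)

theorem irreducible_linePoly {n : ℕ} (θ : Fin n → ℂ) {A : MvPolynomial (Fin n) ℂ}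
    (hA : Irreducible A) : Irreducible (linePoly θ A) := by
  have h : shearEquiv θ (C A) = linePoly θ A := by simp [shearEquiv, shear]
  rw [← h, MulEquiv.irreducible_iff]
  exact (prime_C_iff.2 hA.prime).irreducible

theorem linePoly_monomial {n : ℕ} (θ : Fin n → ℂ) (α : Fin n →₀ ℕ) (c : ℂ) :
    linePoly θ (MvPolynomial.monomial α c) =
      C (MvPolynomial.C c) * ∏ i, (C (MvPolynomial.X i) + C (MvPolynomial.C (θ i)) * X) ^ α i := by
  rw [linePoly, MvPolynomial.aeval_monomial, Finsupp.prod_fintype _ _ (by simp),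
    IsScalarTower.algebraMap_apply ℂ (MvPolynomial (Fin n) ℂ) (MvPolynomial (Fin n) ℂ)[X],
    MvPolynomial.algebraMap_eq, algebraMap_eq]

theorem natDegree_linear_factor_le {n : ℕ} (θ : Fin n → ℂ) (α : Fin n →₀ ℕ) (i : Fin n) :
    ((C (MvPolynomial.X i) + C (MvPolynomial.C (θ i)) * X : (MvPolynomial (Fin n) ℂ)[X]) ^ α i).natDegree
      ≤ α i := by
  refine natDegree_pow_le.trans ?_
  have : (C (MvPolynomial.X i) + C (MvPolynomial.C (θ i)) * X :
      (MvPolynomial (Fin n) ℂ)[X]).natDegree ≤ 1 := by compute_degree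
  calc _ ≤ α i * 1 := Nat.mul_le_mul_left _ this
    _ = _ := mul_one _

theorem natDegree_linePoly_le {n : ℕ} (θ : Fin n → ℂ) (A : MvPolynomial (Fin n) ℂ) :
    (linePoly θ A).natDegree ≤ A.totalDegree := by
  conv_lhs => rw [A.as_sum, map_sum]
  refine natDegree_sum_le_of_forall_le _ _ fun α hα => ?_
  rw [linePoly_monomial]
  refine (natDegree_C_mul_le _ _).trans ((natDegree_prod_le _ _).trans ?_)
  refine (Finset.sum_le_sum fun i _ => natDegree_linear_factor_le θ α i).trans ?_
  have := MvPolynomial.le_totalDegree hα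
  rwa [Finsupp.sum_fintype _ _ (by simp)] at this

theorem coeff_prod_sum_of_natDegree_le {R ι : Type*} [CommRing R] (s : Finset ι) (f : ι → R[X])
    (d : ι → ℕ) (h : ∀ i ∈ s, (f i).natDegree ≤ d i) :
    (∏ i ∈ s, f i).coeff (∑ i ∈ s, d i) = ∏ i ∈ s, (f i).coeff (d i) := by
  classical
  induction s using Finset.induction_on with
  | empty => simp
  | insert a s ha ih =>
    rw [Finset.prod_insert ha, Finset.sum_insert ha, Finset.prod_insert ha,
      coeff_mul_add_eq_of_natDegree_le (h a (Finset.mem_insert_self _ _)), ih]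
    · exact fun i hi => h i (Finset.mem_insert_of_mem hi)
    · exact (natDegree_prod_le _ _).trans
        (Finset.sum_le_sum fun i hi => h i (Finset.mem_insert_of_mem hi))

theorem coeff_linePoly {n : ℕ} (θ : Fin n → ℂ) (A : MvPolynomial (Fin n) ℂ) :
    (linePoly θ A).coeff A.totalDegree = MvPolynomial.C (MvPolynomial.eval θ
      (MvPolynomial.homogeneousComponent A.totalDegree A)) := by
  obtain ⟨d, hd⟩ : ∃ d, d = A.totalDegree := ⟨_, rfl⟩
  rw [← hd]
  conv_lhs => rw [A.as_sum, map_sum, finsetSum_coeff]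
  rw [MvPolynomial.homogeneousComponent_apply, map_sum, map_sum, Finset.sum_filter]
  refine Finset.sum_congr rfl fun α hα => ?_
  have hle : ∑ i, α i ≤ A.totalDegree := by
    have := MvPolynomial.le_totalDegree hα
    rwa [Finsupp.sum_fintype _ _ (by simp)] at this
  have hdeg : α.degree = ∑ i, α i := Finsupp.degree_eq_sum α
  rw [linePoly_monomial, coeff_C_mul]
  have hnd : (∏ i, (C (MvPolynomial.X i) + C (MvPolynomial.C (θ i)) * X :
      (MvPolynomial (Fin n) ℂ)[X]) ^ α i).natDegree ≤ ∑ i, α i :=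
    (natDegree_prod_le _ _).trans (Finset.sum_le_sum fun i _ => natDegree_linear_factor_le θ α i)
  split_ifs with h
  · rw [← h, hdeg, MvPolynomial.eval_monomial, Finsupp.prod_fintype _ _ (by simp)]
    rw [coeff_prod_sum_of_natDegree_le _ _ _ (fun i _ => natDegree_linear_factor_le θ α i)]
    rw [map_mul, map_prod]
    congr 1
    refine Finset.prod_congr rfl fun i _ => ?_
    have : (C (MvPolynomial.X i) + C (MvPolynomial.C (θ i)) * X :
      (MvPolynomial (Fin n) ℂ)[X]).natDegree ≤ 1 := by compute_degree
    have := coeff_pow_of_natDegree_le this (m := α i)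
    rw [mul_one] at this
    rw [this]
    simp
  · rw [coeff_eq_zero_of_natDegree_lt, mul_zero]
    omega


theorem exists_eval_homogeneousComponent_ne_zero {n : ℕ} {A : MvPolynomial (Fin n) ℂ}
    (hA : A ≠ 0) : ∃ θ : Fin n → ℂ, MvPolynomial.eval θ
      (MvPolynomial.homogeneousComponent A.totalDegree A) ≠ 0 := by
  by_contra! h
  have h0 : MvPolynomial.homogeneousComponent A.totalDegree A = 0 :=
    MvPolynomial.funext fun θ => by rw [h θ, map_zero]
  obtain ⟨α, hα, hdeg⟩ := Finset.exists_mem_eq_sup A.support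
    (MvPolynomial.support_nonempty.2 hA) fun s => s.sum fun _ e => e
  have h1 := congrArg (MvPolynomial.coeff α) h0
  rw [MvPolynomial.coeff_homogeneousComponent, if_pos, MvPolynomial.coeff_zero] at h1
  · exact (MvPolynomial.mem_support_iff.1 hα) h1
  · exact hdeg.symm

theorem exists_separating_polynomial {R : Type*} [CommRing R] [IsDomain R] [CharZero R]
    [IsIntegrallyClosed R] [NormalizedGCDMonoid R]
    {p : R[X]} (hp : Irreducible p) (hprim : p.IsPrimitive) :
    ∃ (D : R) (U V : R[X]), D ≠ 0 ∧ U * p + V * derivative p = C D := by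
  let K := FractionRing R
  have h1 : Irreducible (p.map (algebraMap R K)) :=
    hprim.irreducible_iff_irreducible_map_fraction_map.1 hp
  have : CharZero K := (algebraMap R K).charZero_iff (IsFractionRing.injective R K) |>.1 inferInstance
  obtain ⟨u, v, huv⟩ := h1.separable
  obtain ⟨b, hb0, hb⟩ := IsLocalization.integerNormalization_spec (nonZeroDivisors R) u
  obtain ⟨c, hc0, hc⟩ := IsLocalization.integerNormalization_spec (nonZeroDivisors R) v
  refine ⟨b * c, C c * IsLocalization.integerNormalization (nonZeroDivisors R) u,
    C b * IsLocalization.integerNormalization (nonZeroDivisors R) v,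
    mul_ne_zero (nonZeroDivisors.ne_zero hb0) (nonZeroDivisors.ne_zero hc0), ?_⟩
  apply map_injective (algebraMap R K) (IsFractionRing.injective R K)
  have hs : ∀ (r : R) (q : K[X]), r • q = C (algebraMap R K r) * q := fun r q => by
    rw [← algebraMap_smul K r q, smul_eq_C_mul]
  simp only [Polynomial.map_add, Polynomial.map_mul, hb, hc, map_C, hs, map_mul,
    ← derivative_map]
  linear_combination (C (algebraMap R K b) * C (algebraMap R K c)) * huv

/-- Along a suitable direction `θ`, an irreducible polynomial restricts to a nonzero
polynomial on each line, which on generic lines has simple roots and a fixed leading coefficient. -/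
theorem exists_generic_factorization {n : ℕ} {A : MvPolynomial (Fin n) ℂ} (hA : Irreducible A) :
    ∃ (θ : Fin n → ℂ) (a : ℂ) (D : MvPolynomial (Fin n) ℂ), a ≠ 0 ∧ D ≠ 0 ∧
      (∀ z, ∃ p : ℂ[X], p ≠ 0 ∧ ∀ l, MvPolynomial.eval (z + l • θ) A = p.eval l) ∧
      ∀ z, MvPolynomial.eval z D ≠ 0 →
        ∃ S : Finset ℂ, ∀ l, MvPolynomial.eval (z + l • θ) A = a * ∏ b ∈ S, (l - b) := by
  classical
  obtain ⟨θ, hθ⟩ := exists_eval_homogeneousComponent_ne_zero hA.ne_zero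
  set a := MvPolynomial.eval θ (MvPolynomial.homogeneousComponent A.totalDegree A) with ha
  have hcoeff := coeff_linePoly θ A
  rw [← ha] at hcoeff
  have hCa : (MvPolynomial.C a : MvPolynomial (Fin n) ℂ) ≠ 0 := by
    rwa [Ne, MvPolynomial.C_eq_zero]
  have hnat : (linePoly θ A).natDegree = A.totalDegree :=
    natDegree_eq_of_le_of_coeff_ne_zero (natDegree_linePoly_le θ A) (hcoeff ▸ hCa)
  have hprim : (linePoly θ A).IsPrimitive := fun r hr => by
    have h1 := (C_dvd_iff_dvd_coeff r _).1 hr A.totalDegree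
    rw [hcoeff] at h1
    exact isUnit_of_dvd_unit h1 ((isUnit_iff_ne_zero.2 hθ).map MvPolynomial.C)
  let _ : NormalizedGCDMonoid (MvPolynomial (Fin n) ℂ) := Classical.choice inferInstance
  obtain ⟨D, U, V, hD, hUV⟩ := exists_separating_polynomial (irreducible_linePoly θ hA) hprim
  have hc : ∀ z, ((linePoly θ A).map (MvPolynomial.eval z)).coeff A.totalDegree = a := fun z => by
    rw [coeff_map, hcoeff, MvPolynomial.eval_C]
  have hlc : ∀ z, ((linePoly θ A).map (MvPolynomial.eval z)).leadingCoeff = a := fun z => by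
    rw [leadingCoeff, natDegree_eq_of_le_of_coeff_ne_zero
      (natDegree_map_le.trans (natDegree_linePoly_le θ A)) ((hc z).symm ▸ hθ), hc]
  refine ⟨θ, a, D, hθ, hD, fun z => ⟨_, ?_, fun l => (eval_linePoly θ z l A).symm⟩, fun z hz => ?_⟩
  · intro h0
    have := hc z
    rw [h0, coeff_zero] at this
    exact hθ this.symm
  · set p := (linePoly θ A).map (MvPolynomial.eval z) with hp
    have hsep : p.Separable := by
      have h1 := congrArg (Polynomial.map (MvPolynomial.eval z)) hUV
      simp only [Polynomial.map_add, Polynomial.map_mul, map_C, ← derivative_map] at h1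
      refine ⟨C (MvPolynomial.eval z D)⁻¹ * U.map (MvPolynomial.eval z),
        C (MvPolynomial.eval z D)⁻¹ * V.map (MvPolynomial.eval z), ?_⟩
      rw [mul_assoc, mul_assoc, ← mul_add, h1, ← C_mul, inv_mul_cancel₀ hz, C_1]
    refine ⟨p.roots.toFinset, fun l => ?_⟩
    rw [← eval_linePoly, ← hp]
    conv_lhs => rw [(IsAlgClosed.splits p).eq_prod_roots]
    rw [hlc z, eval_mul, eval_C, eval_multiset_prod, Multiset.map_map, Finset.prod,
      Multiset.toFinset_val, Multiset.dedup_eq_self.2 (nodup_roots hsep)]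
    simp

end LineRestriction

theorem continuous_mvPolynomial_eval {n : ℕ} (A : MvPolynomial (Fin n) ℂ) :
    Continuous fun z : Fin n → ℂ => MvPolynomial.eval z A := MvPolynomial.continuous_eval A

theorem differentiable_mvPolynomial_eval {n : ℕ} (A : MvPolynomial (Fin n) ℂ) :
    Differentiable ℂ fun z : Fin n → ℂ => MvPolynomial.eval z A := by
  induction A using MvPolynomial.induction_on with
  | C a => simp
  | add p q hp hq => simpa using hp.fun_add hq
  | mul_X p i hp => simpa using hp.fun_mul (differentiable_apply i)

theorem dense_eval_ne_zero {n : ℕ} {D : MvPolynomial (Fin n) ℂ} (hD : D ≠ 0) :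
    Dense {z : Fin n → ℂ | MvPolynomial.eval z D ≠ 0} := by
  intro z
  by_contra hz
  rw [mem_closure_iff_frequently, not_frequently] at hz
  have hev : (fun z : Fin n → ℂ => MvPolynomial.eval z D) =ᶠ[𝓝 z] fun _ => 0 := by
    filter_upwards [hz] with w hw using not_not.1 hw
  have han : AnalyticOnNhd ℂ (fun z : Fin n → ℂ => MvPolynomial.eval z D) Set.univ :=
    AnalyticOnNhd.eval_mvPolynomial D
  have := han.eq_of_eventuallyEq analyticOnNhd_const hev
  exact hD (MvPolynomial.funext fun w => by simpa using congrFun this w)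

theorem exists_local_cauchy_quotient {n : ℕ} (F G : (Fin n → ℂ) → ℂ) (hF : Differentiable ℂ F)
    (hG : Differentiable ℂ G) (θ z₀ : Fin n → ℂ) {r : ℝ} (hr : 0 < r)
    (hGr : ∀ l ∈ sphere (0 : ℂ) r, G (z₀ + l • θ) ≠ 0) :
    ∃ U ∈ 𝓝 z₀, IsOpen U ∧ ∃ h : (Fin n → ℂ) → ℂ, ContinuousOn h U ∧
      (∀ z ∈ U, ∀ η : Fin n → ℂ, DifferentiableAt ℂ (fun s : ℂ => h (z + s • η)) 0) ∧
      ∀ z ∈ U, ∀ q : ℂ → ℂ, Differentiable ℂ q →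
        (∀ l, F (z + l • θ) = G (z + l • θ) * q l) → h z = q 0 := by
  have hev : ∀ᶠ z in 𝓝 z₀, ∀ l ∈ sphere (0 : ℂ) r, G (z + l • θ) ≠ 0 := by
    refine (isCompact_sphere (0 : ℂ) r).eventually_forall_of_forall_eventually fun l hl => ?_
    have hc : Continuous fun p : (Fin n → ℂ) × ℂ => G (p.1 + p.2 • θ) :=
      hG.continuous.comp (by fun_prop)
    exact hc.continuousAt.eventually_ne (hGr l hl)
  obtain ⟨ρ, hρ, hball⟩ := nhds_basis_closedBall.mem_iff.1 hev
  have hcF : Continuous fun p : (Fin n → ℂ) × ℂ => F (p.1 + p.2 • θ) :=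
    hF.continuous.comp (by fun_prop)
  have hcG : Continuous fun p : (Fin n → ℂ) × ℂ => G (p.1 + p.2 • θ) :=
    hG.continuous.comp (by fun_prop)
  let g : (Fin n → ℂ) → ℂ → ℂ := fun z l => F (z + l • θ) / G (z + l • θ)
  have hgc : ContinuousOn (fun p : (Fin n → ℂ) × ℂ => g p.1 p.2)
      (closedBall z₀ ρ ×ˢ sphere (0 : ℂ) r) :=
    hcF.continuousOn.div hcG.continuousOn fun p hp => hball hp.1 p.2 hp.2
  obtain ⟨M, hM⟩ := ((isCompact_closedBall z₀ ρ).prod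
    (isCompact_sphere (0 : ℂ) r)).exists_bound_of_continuousOn hgc
  have hcm : ∀ t, circleMap 0 r t ∈ sphere (0 : ℂ) r := circleMap_mem_sphere 0 hr.le
  let f : (Fin n → ℂ) → ℝ → ℂ := fun z t =>
    deriv (circleMap 0 r) t • ((circleMap 0 r t - 0)⁻¹ • g z (circleMap 0 r t))
  let μ : Measure ℝ := volume.restrict (Set.Ioc 0 (2 * Real.pi))
  have hbound : ∀ z ∈ closedBall z₀ ρ, ∀ t, ‖f z t‖ ≤ M := by
    intro z hz t
    have h1 := hM (z, circleMap 0 r t) ⟨hz, hcm t⟩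
    have h2 := hcm t
    rw [mem_sphere_zero_iff_norm] at h2
    simp only [f, norm_smul, sub_zero, norm_inv, h2, deriv_circleMap, norm_mul, Complex.norm_I,
      mul_one]
    rwa [← mul_assoc, mul_inv_cancel₀ hr.ne', one_mul]
  have hft : ∀ z ∈ closedBall z₀ ρ, Continuous (f z) := by
    intro z hz
    have h1 : Continuous fun t => g z (circleMap 0 r t) :=
      hgc.comp_continuous (continuous_const.prodMk (continuous_circleMap 0 r))
        fun t => ⟨hz, hcm t⟩
    simp only [f, deriv_circleMap]
    refine ((continuous_circleMap 0 r).mul continuous_const).fun_smul (Continuous.fun_smul ?_ h1)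
    exact ((continuous_circleMap 0 r).sub continuous_const).inv₀ fun t => by
      simpa using hr.ne'
  have hmem : ∀ z ∈ ball z₀ ρ, z ∈ closedBall z₀ ρ := fun z hz => ball_subset_closedBall hz
  have hMint : Integrable (fun _ : ℝ => M) μ := integrable_const M
  have hh : ∀ z, (∮ l in C(0, r), (l - 0)⁻¹ • g z l) = ∫ t, f z t ∂μ := fun z => by
    rw [circleIntegral, intervalIntegral.integral_of_le Real.two_pi_pos.le]
  refine ⟨ball z₀ ρ, ball_mem_nhds z₀ hρ, isOpen_ball,
    fun z => (2 * Real.pi * Complex.I : ℂ)⁻¹ • ∮ l in C(0, r), (l - 0)⁻¹ • g z l, ?_, ?_, ?_⟩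
  · simp_rw [hh]
    refine ContinuousOn.fun_const_smul (fun z hz => ContinuousAt.continuousWithinAt ?_) _
    have hnear : ∀ᶠ w in 𝓝 z, w ∈ ball z₀ ρ := isOpen_ball.mem_nhds hz
    refine continuousAt_of_dominated (bound := fun _ => M) ?_ ?_ hMint (ae_of_all _ fun t => ?_)
    · filter_upwards [hnear] with w hw using (hft w (hmem w hw)).aestronglyMeasurable
    · filter_upwards [hnear] with w hw using ae_of_all _ fun t => hbound w (hmem w hw) t
    · refine ContinuousAt.fun_const_smul (ContinuousAt.fun_const_smul ?_ _) _
      refine ContinuousAt.div ?_ ?_ (hball (hmem z hz) _ (hcm t))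
      · exact (hF.continuous.comp (by fun_prop)).continuousAt
      · exact (hG.continuous.comp (by fun_prop)).continuousAt
  · intro z hz η
    simp_rw [hh]
    refine DifferentiableAt.fun_const_smul ?_ _
    have hline : Continuous fun s : ℂ => z + s • η := by fun_prop
    obtain ⟨δ, hδ, hsub⟩ := Metric.mem_nhds_iff.1
      (hline.continuousAt.preimage_mem_nhds (x := 0)
        (isOpen_ball.mem_nhds (by simpa using hz) : ball z₀ ρ ∈ _))
    refine differentiableAt_integral_of_dominated hδ hMint
      (f := fun s t => f (z + s • η) t) ?_ ?_ ?_
    · exact fun s hs => (hft _ (hmem _ (hsub hs))).aestronglyMeasurable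
    · intro t s hs
      refine DifferentiableAt.differentiableWithinAt ?_
      refine DifferentiableAt.fun_const_smul (DifferentiableAt.fun_const_smul ?_ _) _
      have hd : DifferentiableAt ℂ (fun s : ℂ => z + s • η + circleMap 0 r t • θ) s := by fun_prop
      exact ((hF _).comp s hd).div ((hG _).comp s hd) (hball (hmem _ (hsub hs)) _ (hcm t))
    · exact fun s hs t => hbound _ (hmem _ (hsub hs)) t
  · intro z hz q hq hFq
    have h1 : (∮ l in C(0, r), (l - 0)⁻¹ • g z l) = ∮ l in C(0, r), (l - 0)⁻¹ • q l := by
      refine circleIntegral.integral_congr hr.le fun l hl => ?_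
      have := hball (hmem z hz) l hl
      simp only [g, hFq l, mul_div_cancel_left₀ _ this]
    simp only [h1]
    exact hq.diffContOnCl.two_pi_i_inv_smul_circleIntegral_sub_inv_smul (mem_ball_self hr)

theorem exists_division {n : ℕ} {A : MvPolynomial (Fin n) ℂ} (hA : Irreducible A) :
    ∃ (θ : Fin n → ℂ) (C : ℝ), ∀ F : (Fin n → ℂ) → ℂ, Differentiable ℂ F →
      (∀ z, MvPolynomial.eval z A = 0 → F z = 0) →
      ∃ h : (Fin n → ℂ) → ℂ, Continuous h ∧
        (∀ z η, Differentiable ℂ fun s : ℂ => h (z + s • η)) ∧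
        (∀ z, F z = MvPolynomial.eval z A * h z) ∧
        ∀ B : (Fin n → ℂ) → ℝ, Continuous B →
          (∀ z, ∀ l : ℂ, ‖l‖ = 1 → ‖F (z + l • θ)‖ ≤ B z) → ∀ z, ‖h z‖ ≤ C * B z := by
  obtain ⟨θ, a, D, ha, hD, hline, hgen⟩ := exists_generic_factorization hA
  refine ⟨θ, ‖a‖⁻¹, fun F hF hFA => ?_⟩
  set G : Set (Fin n → ℂ) := {z | MvPolynomial.eval z D ≠ 0} with hG
  have hGd : Dense G := dense_eval_ne_zero hD
  have hq : ∀ z ∈ G, ∃ q : ℂ → ℂ, Differentiable ℂ q ∧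
      (∀ l, F (z + l • θ) = MvPolynomial.eval (z + l • θ) A * q l) ∧
      ∀ b : ℝ, (∀ l : ℂ, ‖l‖ = 1 → ‖F (z + l • θ)‖ ≤ b) → ‖q 0‖ ≤ ‖a‖⁻¹ * b := by
    intro z hz
    obtain ⟨S, hS⟩ := hgen z hz
    have hlin : Differentiable ℂ fun l : ℂ => F (z + l • θ) := hF.comp (by fun_prop)
    obtain ⟨q, hqd, hqf⟩ := exists_entire_quotient S _ hlin fun b hb => hFA _ (by
      rw [hS b, Finset.prod_eq_zero hb (sub_self b), mul_zero])
    refine ⟨fun l => a⁻¹ * q l, by fun_prop, fun l => ?_, fun b hb => ?_⟩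
    · rw [hqf l, hS l]
      field_simp
    · rw [norm_mul, norm_inv]
      refine mul_le_mul_of_nonneg_left ?_ (by positivity)
      exact norm_quotient_zero_le S q hqd b fun l hl => hqf l ▸ hb l hl
  choose! q hqd hqF hqb using hq
  have hloc : ∀ z₀, ∃ U ∈ 𝓝 z₀, IsOpen U ∧ ∃ h : (Fin n → ℂ) → ℂ, ContinuousOn h U ∧
      (∀ z ∈ U, ∀ η : Fin n → ℂ, DifferentiableAt ℂ (fun s : ℂ => h (z + s • η)) 0) ∧
      ∀ z ∈ U, z ∈ G → h z = q z 0 := by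
    intro z₀
    obtain ⟨p, hp, hpe⟩ := hline z₀
    obtain ⟨r, hr, hrp⟩ : ∃ r : ℝ, 0 < r ∧ ∀ l ∈ sphere (0 : ℂ) r, p.eval l ≠ 0 := by
      have hfin : ((fun l : ℂ => ‖l‖) '' {l | p.IsRoot l}).Finite :=
        (Polynomial.finite_setOfPred_isRoot hp).image _
      obtain ⟨r, hr, hr'⟩ := (Set.Ioi_infinite (0 : ℝ)).exists_notMem_finite hfin
      refine ⟨r, hr, fun l hl h0 => hr' ⟨l, h0, by simpa using hl⟩⟩
    obtain ⟨U, hU, hUo, h, h1, h2, h3⟩ := exists_local_cauchy_quotient F _ hF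
      (differentiable_mvPolynomial_eval A) θ z₀ hr fun l hl => by rw [hpe]; exact hrp l hl
    exact ⟨U, hU, hUo, h, h1, h2, fun z hz hzG => h3 z hz (q z) (hqd z hzG) (hqF z hzG)⟩
  choose U hU hUo hl hlc hld hlq using hloc
  have heq : ∀ z₀, ∀ z ∈ U z₀, hl z z = hl z₀ z := by
    intro z₀ z hz
    have : (𝓝[G] z).NeBot := mem_closure_iff_nhdsWithin_neBot.1 (hGd z)
    have hz₀ : U z₀ ∈ 𝓝 z := (hUo z₀).mem_nhds hz
    refine tendsto_nhds_unique_of_eventuallyEq (l := 𝓝[G] z)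
      (((hlc z).continuousAt (hU z)).tendsto.mono_left nhdsWithin_le_nhds)
      (((hlc z₀).continuousAt hz₀).tendsto.mono_left nhdsWithin_le_nhds) ?_
    filter_upwards [nhdsWithin_le_nhds (hU z), nhdsWithin_le_nhds hz₀, self_mem_nhdsWithin]
      with w h1 h2 h3
    rw [hlq z w h1 h3, hlq z₀ w h2 h3]
  have hev : ∀ z₀, (fun z => hl z z) =ᶠ[𝓝 z₀] hl z₀ := fun z₀ => by
    filter_upwards [hU z₀] with z hz using heq z₀ z hz
  have hcont : Continuous fun z => hl z z := continuous_iff_continuousAt.2 fun z₀ =>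
    ((hlc z₀).continuousAt (hU z₀)).congr (hev z₀).symm
  have hGq : ∀ z ∈ G, hl z z = q z 0 := fun z hz => hlq z z (mem_of_mem_nhds (hU z)) hz
  refine ⟨fun z => hl z z, hcont, fun z η s => ?_, fun z => ?_, fun B hB hFB z => ?_⟩
  · have h1 := hld (z + s • η) _ (mem_of_mem_nhds (hU _)) η
    have h2 : DifferentiableAt ℂ (fun t : ℂ => hl (z + s • η + t • η) (z + s • η + t • η)) 0 := by
      refine h1.congr_of_eventuallyEq ?_
      have hc : ContinuousAt (fun t : ℂ => z + s • η + t • η) 0 := by fun_prop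
      have h3 : Tendsto (fun t : ℂ => z + s • η + t • η) (𝓝 0) (𝓝 (z + s • η)) := by
        simpa using hc.tendsto
      exact h3.eventually (hev (z + s • η))
    have h3 : DifferentiableAt ℂ (fun t : ℂ => t - s) s := by fun_prop
    have h4 := DifferentiableAt.comp s (by simpa using h2) h3
    refine h4.congr_of_eventuallyEq (Eventually.of_forall fun t => ?_)
    have : z + s • η + (t - s) • η = z + t • η := by rw [sub_smul]; abel
    simp only [Function.comp, this]
  · refine congrFun (Continuous.ext_on hGd hF.continuous
      ((continuous_mvPolynomial_eval A).fun_mul hcont) fun w hw => ?_) z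
    have := hqF w hw 0
    simp only [zero_smul, add_zero] at this
    simp only [hGq w hw, this]
  · refine (isClosed_le hcont.norm (continuous_const.mul hB)).closure_subset_iff.2
      (fun w hw => ?_) (hGd z)
    simp only [Set.mem_ofPred_eq, hGq w hw]
    exact hqb w hw _ (hFB w)

/-- The complex bilinear pairing of a real point with a complex frequency. -/
noncomputable def dotC {n : ℕ} (x : Fin n → ℝ) (z : Fin n → ℂ) : ℂ := ∑ i, (x i : ℂ) * z i

/-- The bilateral Laplace transform. -/
noncomputable def laplace {n : ℕ} (w : (Fin n → ℝ) → ℂ) (z : Fin n → ℂ) : ℂ :=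
  ∫ x, w x * Complex.exp (-dotC x z)

/-- The purely imaginary frequency `2πiξ`. -/
noncomputable def freq {n : ℕ} (ξ : Fin n → ℝ) : Fin n → ℂ :=
  fun j => 2 * Real.pi * Complex.I * ξ j

/-- Smooth compactly supported functions. -/
def IsTest {n : ℕ} (w : (Fin n → ℝ) → ℂ) : Prop := ContDiff ℝ ∞ w ∧ HasCompactSupport w

theorem continuous_dotC {n : ℕ} :
    Continuous fun p : (Fin n → ℝ) × (Fin n → ℂ) => dotC p.1 p.2 := by
  unfold dotC; fun_prop

theorem contDiff_dotC {n : ℕ} (z : Fin n → ℂ) : ContDiff ℝ ∞ fun x : Fin n → ℝ => dotC x z := by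
  unfold dotC
  refine ContDiff.sum fun i _ => ContDiff.mul ?_ contDiff_const
  exact Complex.ofRealCLM.contDiff.comp (contDiff_apply ℝ ℝ i)

theorem dotC_add {n : ℕ} (x : Fin n → ℝ) (z w : Fin n → ℂ) :
    dotC x (z + w) = dotC x z + dotC x w := by
  simp [dotC, mul_add, Finset.sum_add_distrib]

theorem dotC_smul {n : ℕ} (x : Fin n → ℝ) (s : ℂ) (z : Fin n → ℂ) :
    dotC x (s • z) = s * dotC x z := by
  simp [dotC, Finset.mul_sum, mul_left_comm]

theorem norm_dotC_le {n : ℕ} (x : Fin n → ℝ) (z : Fin n → ℂ) :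
    ‖dotC x z‖ ≤ n * (‖x‖ * ‖z‖) := by
  refine (norm_sum_le _ _).trans ?_
  calc ∑ i, ‖(x i : ℂ) * z i‖ ≤ ∑ _i : Fin n, ‖x‖ * ‖z‖ := by
        refine Finset.sum_le_sum fun i _ => ?_
        rw [norm_mul, Complex.norm_real]
        exact mul_le_mul (norm_le_pi_norm x i) (norm_le_pi_norm z i) (norm_nonneg _) (norm_nonneg _)
    _ = _ := by simp

theorem dotC_freq_re {n : ℕ} (x ξ : Fin n → ℝ) : (dotC x (freq ξ)).re = 0 := by
  simp [dotC, freq]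

theorem pd_cexp {n : ℕ} (j : Fin n) (z : Fin n → ℂ) (x : Fin n → ℝ) :
    pd j (fun y => Complex.exp (dotC y z)) x = z j * Complex.exp (dotC x z) := by
  have h : HasFDerivAt (fun y : Fin n → ℝ => dotC y z)
      (∑ i, (Complex.ofRealCLM.comp (ContinuousLinearMap.proj i :
        (Fin n → ℝ) →L[ℝ] ℝ)).smulRight (z i)) x := by
    have : (fun y : Fin n → ℝ => dotC y z) = fun y => (∑ i, (Complex.ofRealCLM.comp
        (ContinuousLinearMap.proj i : (Fin n → ℝ) →L[ℝ] ℝ)).smulRight (z i)) y := by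
      ext y; simp [dotC]
    rw [this]
    exact ContinuousLinearMap.hasFDerivAt _
  rw [pd, h.cexp.fderiv]
  simp [Pi.single_apply, mul_comm, apply_ite Complex.ofReal]

namespace IsTest

variable {n : ℕ} {w v : (Fin n → ℝ) → ℂ}

theorem differentiable (hw : IsTest w) : Differentiable ℝ w := hw.1.differentiable (by simp)

theorem pd (hw : IsTest w) (j : Fin n) : IsTest (_root_.pd j w) :=
  ⟨(hw.1.fderiv_right (m := ∞) (by simp)).clm_apply contDiff_const,
    (hw.2.fderiv (𝕜 := ℝ)).comp_left
      (g := fun L : (Fin n → ℝ) →L[ℝ] ℂ => L (Pi.single j 1)) rfl⟩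

theorem mul_exp (hw : IsTest w) {g : (Fin n → ℝ) → ℂ} (hg : ContDiff ℝ ∞ g) :
    IsTest fun x => w x * g x :=
  ⟨hw.1.mul hg, hw.2.mul_right⟩

theorem add (hw : IsTest w) (hv : IsTest v) : IsTest fun x => w x + v x :=
  ⟨hw.1.add hv.1, hw.2.add hv.2⟩

theorem const_mul (hw : IsTest w) (c : ℂ) : IsTest fun x => c * w x :=
  ⟨contDiff_const.mul hw.1, hw.2.mul_left⟩

theorem sum {ι : Type*} (s : Finset ι) {w : ι → (Fin n → ℝ) → ℂ} (hw : ∀ i ∈ s, IsTest (w i)) :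
    IsTest fun x => ∑ i ∈ s, w i x := by
  classical
  induction s using Finset.induction_on with
  | empty =>
    simp only [Finset.sum_empty]
    exact ⟨contDiff_const, HasCompactSupport.zero⟩
  | insert a s ha ih =>
    simp only [Finset.sum_insert ha]
    exact (hw a (Finset.mem_insert_self _ _)).add
      (ih fun i hi => hw i (Finset.mem_insert_of_mem hi))

theorem integrable (hw : IsTest w) : Integrable w :=
  hw.1.continuous.integrable_of_hasCompactSupport hw.2

end IsTest

section Laplace

variable {n : ℕ} {w : (Fin n → ℝ) → ℂ}

theorem tsupport_pd_subset (j : Fin n) : tsupport (pd j w) ⊆ tsupport w :=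
  (tsupport_comp_subset (g := fun L : (Fin n → ℝ) →L[ℝ] ℂ => L (Pi.single j 1)) rfl
    (fderiv ℝ w)).trans (tsupport_fderiv_subset ℝ)

theorem IsTest.mul_cexp (hw : IsTest w) (z : Fin n → ℂ) :
    IsTest fun x => w x * Complex.exp (-dotC x z) :=
  hw.mul_exp (contDiff_dotC z).neg.cexp

theorem laplace_pd (hw : IsTest w) (j : Fin n) (z : Fin n → ℂ) :
    laplace (pd j w) z = z j * laplace w z := by
  have hE : ContDiff ℝ ∞ fun x : Fin n → ℝ => Complex.exp (dotC x (-z)) := (contDiff_dotC (-z)).cexp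
  have hneg : ∀ x : Fin n → ℝ, -dotC x z = dotC x (-z) := fun x => by simp [dotC]
  have hpd : ∀ x, fderiv ℝ (fun y : Fin n → ℝ => Complex.exp (dotC y (-z))) x (Pi.single j 1)
      = -z j * Complex.exp (dotC x (-z)) := fun x => pd_cexp j (-z) x
  simp only [laplace, hneg]
  have h1 : ∫ x, fderiv ℝ w x (Pi.single j 1) * Complex.exp (dotC x (-z)) = - ∫ x, w x * fderiv ℝ
      (fun y : Fin n → ℝ => Complex.exp (dotC y (-z))) x (Pi.single j 1) := by
    rw [integral_mul_fderiv_eq_neg_fderiv_mul_of_integrable, neg_neg]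
    · exact ((hw.pd j).mul_exp hE).integrable
    · simp only [hpd]
      exact (hw.mul_exp (contDiff_const.mul hE)).integrable
    · exact (hw.mul_exp hE).integrable
    · exact fun x _ => hw.differentiable x
    · exact fun x _ => hE.differentiable (by simp) x
  refine h1.trans ?_
  simp only [hpd]
  rw [← integral_neg, ← integral_const_mul]
  congr 1; ext x; ring

theorem laplace_bound (M : ℕ) (hw : IsTest w) : ∃ C : ℝ, 0 ≤ C ∧ ∀ (z : Fin n → ℂ) (b : ℝ),
    (∀ x ∈ tsupport w, -(dotC x z).re ≤ b) → (1 + ‖z‖) ^ M * ‖laplace w z‖ ≤ C * Real.exp b := by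
  induction M generalizing w with
  | zero =>
    refine ⟨∫ x, ‖w x‖, integral_nonneg fun x => norm_nonneg _, fun z b hb => ?_⟩
    rw [pow_zero, one_mul, ← integral_mul_const]
    refine norm_integral_le_of_norm_le (hw.integrable.norm.mul_const _) (ae_of_all _ fun x => ?_)
    rw [norm_mul, Complex.norm_exp, Complex.neg_re]
    by_cases hx : x ∈ tsupport w
    · gcongr; exact hb x hx
    · simp [image_eq_zero_of_notMem_tsupport hx]
  | succ M ih =>
    obtain ⟨C, hC, h0⟩ := ih hw
    choose D hD h1 using fun j => ih (hw.pd j)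
    refine ⟨C + ∑ j, D j, add_nonneg hC (Finset.sum_nonneg fun j _ => hD j), fun z b hb => ?_⟩
    have hz : ‖z‖ ≤ ∑ j, ‖z j‖ := (pi_norm_le_iff_of_nonneg (by positivity)).2 fun j =>
      Finset.single_le_sum (f := fun j => ‖z j‖) (fun i _ => norm_nonneg _) (Finset.mem_univ j)
    have h2 : ∀ j, (1 + ‖z‖) ^ M * (‖z j‖ * ‖laplace w z‖) ≤ D j * Real.exp b := fun j => by
      rw [← norm_mul, ← laplace_pd hw]
      exact h1 j z b fun x hx => hb x (tsupport_pd_subset j hx)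
    calc (1 + ‖z‖) ^ (M + 1) * ‖laplace w z‖
        = (1 + ‖z‖) ^ M * ‖laplace w z‖ * (1 + ‖z‖) := by ring
      _ ≤ (1 + ‖z‖) ^ M * ‖laplace w z‖ * (1 + ∑ j, ‖z j‖) := by gcongr
      _ = (1 + ‖z‖) ^ M * ‖laplace w z‖ + ∑ j, (1 + ‖z‖) ^ M * (‖z j‖ * ‖laplace w z‖) := by
        rw [mul_add, mul_one, Finset.mul_sum]
        congr 1
        exact Finset.sum_congr rfl fun j _ => by ring
      _ ≤ C * Real.exp b + ∑ j, D j * Real.exp b := by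
        exact add_le_add (h0 z b hb) (Finset.sum_le_sum fun j _ => h2 j)
      _ = _ := by rw [add_mul, Finset.sum_mul]

theorem IsTest.norm_mul_cexp_le (hw : IsTest w) : ∃ R : ℝ, 0 ≤ R ∧ ∀ (x : Fin n → ℝ)
    (z : Fin n → ℂ), ‖w x * Complex.exp (-dotC x z)‖ ≤ ‖w x‖ * Real.exp (R * ‖z‖) := by
  obtain ⟨R, hR⟩ := hw.2.isBounded.exists_norm_le
  refine ⟨n * max R 0, by positivity, fun x z => ?_⟩
  rw [norm_mul, Complex.norm_exp, Complex.neg_re]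
  by_cases hx : x ∈ tsupport w
  · gcongr
    calc -(dotC x z).re ≤ ‖dotC x z‖ := (neg_le_abs _).trans (Complex.abs_re_le_norm _)
      _ ≤ n * (‖x‖ * ‖z‖) := norm_dotC_le x z
      _ ≤ n * (max R 0 * ‖z‖) := by gcongr; exact (hR x hx).trans (le_max_left _ _)
      _ = _ := by ring
  · simp [image_eq_zero_of_notMem_tsupport hx]

theorem continuous_laplace (hw : IsTest w) : Continuous (laplace w) := by
  obtain ⟨R, hR0, hR⟩ := hw.norm_mul_cexp_le
  refine continuous_iff_continuousAt.2 fun z => continuousAt_of_dominated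
    (bound := fun x => ‖w x‖ * Real.exp (R * (‖z‖ + 1))) ?_ ?_
    (hw.integrable.norm.mul_const _) (ae_of_all _ fun x => ?_)
  · exact Eventually.of_forall fun y => (hw.mul_cexp y).1.continuous.aestronglyMeasurable
  · filter_upwards [ball_mem_nhds z one_pos] with y hy
    refine ae_of_all _ fun x => (hR x y).trans ?_
    have : ‖y‖ ≤ ‖z‖ + 1 := by
      have := norm_sub_norm_le y z
      rw [mem_ball_iff_norm] at hy
      linarith
    gcongr
  · have : Continuous fun y : Fin n → ℂ => dotC x y :=
      continuous_dotC.comp (continuous_const.prodMk continuous_id)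
    fun_prop

theorem differentiable_laplace_line (hw : IsTest w) (z η : Fin n → ℂ) :
    Differentiable ℂ fun s : ℂ => laplace w (z + s • η) := by
  obtain ⟨R, hR0, hR⟩ := hw.norm_mul_cexp_le
  intro s₀
  refine differentiableAt_integral_of_dominated one_pos
    (f := fun s x => w x * Complex.exp (-dotC x (z + s • η)))
    (bound := fun x => ‖w x‖ * Real.exp (R * (‖z‖ + (‖s₀‖ + 1) * ‖η‖)))
    (hw.integrable.norm.mul_const _) ?_ ?_ ?_
  · exact fun s _ => (hw.mul_cexp _).1.continuous.aestronglyMeasurable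
  · intro x
    simp only [dotC_add, dotC_smul]
    fun_prop
  · intro s hs x
    refine (hR x _).trans ?_
    have h1 : ‖s‖ ≤ ‖s₀‖ + 1 := by
      have := norm_sub_norm_le s s₀
      rw [mem_ball_iff_norm] at hs
      linarith
    have : ‖z + s • η‖ ≤ ‖z‖ + (‖s₀‖ + 1) * ‖η‖ := by
      refine (norm_add_le _ _).trans ?_
      rw [norm_smul]
      gcongr
    gcongr

theorem norm_freq {ξ : Fin n → ℝ} : ‖ξ‖ ≤ ‖freq ξ‖ := by
  refine (pi_norm_le_iff_of_nonneg (norm_nonneg _)).2 fun j => ?_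
  refine le_trans ?_ (norm_le_pi_norm (freq ξ) j)
  simp only [freq, norm_mul, Complex.norm_real, Complex.norm_I, mul_one, Complex.norm_ofNat]
  rw [Real.norm_of_nonneg Real.pi_pos.le]
  nlinarith [Real.pi_gt_three, norm_nonneg (ξ j)]

theorem continuous_freq : Continuous (freq : (Fin n → ℝ) → Fin n → ℂ) := by
  unfold freq; fun_prop

theorem integrable_one_add_norm_pow (n : ℕ) :
    Integrable fun ξ : Fin n → ℝ => ((1 + ‖ξ‖) ^ (n + 1))⁻¹ := by
  have := integrable_one_add_norm (E := Fin n → ℝ) (μ := volume) (r := (n + 1 : ℕ)) (by simp)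
  refine this.congr (ae_of_all _ fun ξ => ?_)
  simp only
  rw [Real.rpow_neg (by positivity), Real.rpow_natCast]

theorem integrable_laplace_freq (hw : IsTest w) : Integrable fun ξ => laplace w (freq ξ) := by
  obtain ⟨C, hC, h⟩ := laplace_bound (n + 1) hw
  refine ((integrable_one_add_norm_pow n).const_mul C).mono'
    ((continuous_laplace hw).comp continuous_freq).aestronglyMeasurable (ae_of_all _ fun ξ => ?_)
  have h1 := h (freq ξ) 0 fun x _ => by simp [dotC_freq_re]
  rw [Real.exp_zero, mul_one] at h1
  rw [← div_eq_mul_inv, le_div_iff₀ (by positivity), mul_comm]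
  refine le_trans ?_ h1
  gcongr
  exact norm_freq

theorem laplace_inversion (hw : IsTest w) (x : Fin n → ℝ) :
    ∫ ξ, laplace w (freq ξ) * Complex.exp (dotC x (freq ξ)) = w x := by
  let e := MeasurableEquiv.toLp 2 (Fin n → ℝ)
  have he : MeasurePreserving e := PiLp.volume_preserving_toLp (Fin n)
  let f : EuclideanSpace ℝ (Fin n) → ℂ := fun y => w y.ofLp
  have hinner : ∀ y ξ : Fin n → ℝ, ((2 * Real.pi * inner ℝ (WithLp.toLp 2 y) (WithLp.toLp 2 ξ) : ℝ) : ℂ)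
      * Complex.I = dotC y (freq ξ) := fun y ξ => by
    simp only [PiLp.inner_apply, RCLike.inner_apply, dotC, freq, conj_trivial]
    push_cast
    rw [Finset.mul_sum, Finset.sum_mul]
    exact Finset.sum_congr rfl fun i _ => by ring
  have hF : ∀ ξ : Fin n → ℝ, 𝓕 f (e ξ) = laplace w (freq ξ) := fun ξ => by
    rw [Real.fourier_eq', laplace, ← he.integral_comp e.measurableEmbedding]
    congr 1; ext y
    simp only [e, MeasurableEquiv.coe_toLp, f, smul_eq_mul]
    rw [mul_comm, ← hinner]
    congr 2
    push_cast; ring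
  have hc : Continuous f := hw.1.continuous.comp (PiLp.continuous_ofLp 2 _)
  have hi : Integrable f := by
    rw [← he.integrable_comp_emb e.measurableEmbedding]
    exact hw.integrable
  have hFi : Integrable (𝓕 f) := by
    rw [← he.integrable_comp_emb e.measurableEmbedding]
    exact (integrable_laplace_freq hw).congr (ae_of_all _ fun ξ => (hF ξ).symm)
  have h := congrFun (hc.fourierInv_fourier_eq hi hFi) (e x)
  rw [Real.fourierInv_eq', ← he.integral_comp e.measurableEmbedding] at h
  simp only [hF] at h
  refine Eq.trans ?_ h
  congr 1; ext ξ
  rw [smul_eq_mul, mul_comm, ← hinner]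
  congr 3
  simp only [e, MeasurableEquiv.coe_toLp, real_inner_comm]

end Laplace

/-- Entire functions whose growth is controlled by a polynomial times the exponential of the
support function of `K`. -/
structure IsPaleyWiener {n : ℕ} (K : Set (Fin n → ℝ)) (h : (Fin n → ℂ) → ℂ) : Prop where
  continuous : Continuous h
  differentiable_line : ∀ z η, Differentiable ℂ fun s : ℂ => h (z + s • η)
  bound : ∃ (N : ℕ) (C : ℝ), ∀ (z : Fin n → ℂ) (b : ℝ),
    (∀ x ∈ K, (dotC x z).re ≤ b) → ‖h z‖ ≤ C * (1 + ‖z‖) ^ N * Real.exp b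

section Shift

variable {n : ℕ} {K : Set (Fin n → ℝ)} {h : (Fin n → ℂ) → ℂ} {w : (Fin n → ℝ) → ℂ}

theorem IsPaleyWiener.mul_laplace_bound (hh : IsPaleyWiener K h) (hw : IsTest w) :
    ∃ C : ℝ, 0 ≤ C ∧ ∀ (z : Fin n → ℂ) (b b' : ℝ), (∀ x ∈ K, (dotC x z).re ≤ b) →
      (∀ x ∈ tsupport w, -(dotC x z).re ≤ b') →
      (1 + ‖z‖) ^ (n + 1) * ‖h z * laplace w z‖ ≤ C * Real.exp (b + b') := by
  obtain ⟨N, C₁, h₁⟩ := hh.bound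
  obtain ⟨C₂, hC₂, h₂⟩ := laplace_bound (N + (n + 1)) hw
  refine ⟨|C₁| * C₂, by positivity, fun z b b' hb hb' => ?_⟩
  have h3 : ‖h z‖ ≤ |C₁| * (1 + ‖z‖) ^ N * Real.exp b := by
    refine (h₁ z b hb).trans ?_
    gcongr
    exact le_abs_self _
  have h4 := h₂ z b' hb'
  calc (1 + ‖z‖) ^ (n + 1) * ‖h z * laplace w z‖
      = (1 + ‖z‖) ^ (n + 1) * (‖h z‖ * ‖laplace w z‖) := by rw [norm_mul]
    _ ≤ (1 + ‖z‖) ^ (n + 1) * ((|C₁| * (1 + ‖z‖) ^ N * Real.exp b) * ‖laplace w z‖) := by gcongr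
    _ = |C₁| * Real.exp b * ((1 + ‖z‖) ^ (N + (n + 1)) * ‖laplace w z‖) := by ring
    _ ≤ |C₁| * Real.exp b * (C₂ * Real.exp b') := by gcongr
    _ = _ := by rw [Real.exp_add]; ring

theorem IsPaleyWiener.integrable_mul_laplace (hh : IsPaleyWiener K h) (hw : IsTest w) :
    Integrable fun ξ => h (freq ξ) * laplace w (freq ξ) := by
  obtain ⟨C, hC, hb⟩ := hh.mul_laplace_bound hw
  refine ((integrable_one_add_norm_pow n).const_mul C).mono'
    ((hh.continuous.mul (continuous_laplace hw)).comp continuous_freq).aestronglyMeasurable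
    (ae_of_all _ fun ξ => ?_)
  have h1 := hb (freq ξ) 0 0 (fun x _ => by simp [dotC_freq_re]) fun x _ => by simp [dotC_freq_re]
  rw [add_zero, Real.exp_zero, mul_one] at h1
  rw [← div_eq_mul_inv, le_div_iff₀ (by positivity), mul_comm]
  refine le_trans ?_ h1
  gcongr
  exact norm_freq

theorem dotC_ofReal (x η : Fin n → ℝ) :
    dotC x (fun i => (η i : ℂ)) = ((∑ i, x i * η i : ℝ) : ℂ) := by
  simp [dotC]

theorem dotC_shift_re (x ξ η : Fin n → ℝ) (s : ℂ) :
    (dotC x (freq ξ + s • fun i => (η i : ℂ))).re = s.re * ∑ i, x i * η i := by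
  rw [dotC_add, dotC_smul, dotC_ofReal, Complex.add_re, dotC_freq_re, Complex.re_mul_ofReal,
    zero_add]

theorem norm_le_norm_freq_add (ξ η : Fin n → ℝ) (t : ℝ) :
    ‖ξ‖ ≤ ‖freq ξ + (t : ℂ) • fun i => (η i : ℂ)‖ := by
  refine (pi_norm_le_iff_of_nonneg (norm_nonneg _)).2 fun j => ?_
  refine le_trans ?_ (norm_le_pi_norm _ j)
  refine le_trans ?_ (Complex.abs_im_le_norm _)
  simp only [freq, Pi.add_apply, Pi.smul_apply, smul_eq_mul, Complex.add_im, Complex.mul_im,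
    Complex.ofReal_im, Complex.ofReal_re, Complex.I_re, Complex.I_im, Complex.mul_re,
    Complex.re_ofNat, Complex.im_ofNat]
  ring_nf
  rw [abs_mul, abs_mul, abs_of_pos Real.pi_pos, abs_two, Real.norm_eq_abs]
  nlinarith [Real.pi_gt_three, abs_nonneg (ξ j)]

theorem norm_le_norm_freq_add_smul (ξ : Fin n → ℝ) (η : Fin n → ℂ) (s : ℂ) :
    1 + ‖ξ‖ ≤ (1 + ‖s‖ * ‖η‖) * (1 + ‖freq ξ + s • η‖) := by
  have h1 : ‖freq ξ‖ ≤ ‖freq ξ + s • η‖ + ‖s‖ * ‖η‖ := by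
    rw [← norm_smul]
    exact norm_le_add_norm_add _ _
  have h2 := norm_freq (ξ := ξ)
  have : 0 ≤ ‖s‖ * ‖η‖ * ‖freq ξ + s • η‖ := by positivity
  linarith

/-- The integral over a shifted imaginary subspace does not depend on the shift. -/
theorem IsPaleyWiener.integral_shift_eq (hh : IsPaleyWiener K h) (hK : IsCompact K)
    (hw : IsTest w) (η : Fin n → ℝ) (s : ℂ) :
    ∫ ξ, h (freq ξ + s • fun i => (η i : ℂ)) * laplace w (freq ξ + s • fun i => (η i : ℂ)) =
      ∫ ξ, h (freq ξ) * laplace w (freq ξ) := by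
  set ηC : Fin n → ℂ := fun i => (η i : ℂ) with hηC
  set φ : (Fin n → ℂ) → ℂ := fun z => h z * laplace w z with hφ
  have hφc : Continuous φ := hh.continuous.mul (continuous_laplace hw)
  obtain ⟨C, hC, hb⟩ := hh.mul_laplace_bound hw
  obtain ⟨P, hP⟩ : ∃ P : ℝ, ∀ x ∈ K ∪ tsupport w, ‖∑ i, x i * η i‖ ≤ P :=
    (hK.union hw.2).exists_bound_of_continuousOn (by fun_prop)
  set I : ℂ → ℂ := fun s => ∫ ξ, φ (freq ξ + s • ηC) with hI
  have hdiff : Differentiable ℂ I := by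
    intro s₀
    set R := ‖s₀‖ + 1
    refine differentiableAt_integral_of_dominated one_pos
      (f := fun s ξ => φ (freq ξ + s • ηC))
      (bound := fun ξ => C * Real.exp (R * P + R * P) * (1 + R * ‖ηC‖) ^ (n + 1) *
        ((1 + ‖ξ‖) ^ (n + 1))⁻¹)
      ((integrable_one_add_norm_pow n).const_mul _) ?_ ?_ ?_
    · intro s _
      exact (hφc.comp (continuous_freq.add continuous_const)).aestronglyMeasurable
    · intro ξ
      exact ((hh.differentiable_line _ _).mul
        (differentiable_laplace_line hw _ _)).differentiableOn
    · intro s hs ξ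
      have hsR : ‖s‖ ≤ R := by
        have := norm_sub_norm_le s s₀
        rw [mem_ball_iff_norm] at hs
        simp only [R]; linarith
      have hre : ∀ x ∈ K ∪ tsupport w, |(dotC x (freq ξ + s • ηC)).re| ≤ R * P := fun x hx => by
        rw [hηC, dotC_shift_re, abs_mul]
        exact mul_le_mul ((Complex.abs_re_le_norm s).trans hsR) (hP x hx) (abs_nonneg _)
          (by positivity)
      have h1 := hb (freq ξ + s • ηC) (R * P) (R * P)
        (fun x hx => (le_abs_self _).trans (hre x (Or.inl hx)))
        (fun x hx => (neg_le_abs _).trans (hre x (Or.inr hx)))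
      rw [← div_eq_mul_inv, le_div_iff₀ (by positivity)]
      calc ‖φ (freq ξ + s • ηC)‖ * (1 + ‖ξ‖) ^ (n + 1)
          ≤ ‖φ (freq ξ + s • ηC)‖ * ((1 + R * ‖ηC‖) * (1 + ‖freq ξ + s • ηC‖)) ^ (n + 1) := by
            have := norm_le_norm_freq_add_smul ξ ηC s
            have h2 : (1 + ‖s‖ * ‖ηC‖) * (1 + ‖freq ξ + s • ηC‖) ≤
              (1 + R * ‖ηC‖) * (1 + ‖freq ξ + s • ηC‖) := by gcongr
            gcongr
            exact this.trans h2
        _ = (1 + ‖freq ξ + s • ηC‖) ^ (n + 1) * ‖φ (freq ξ + s • ηC)‖ *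
            (1 + R * ‖ηC‖) ^ (n + 1) := by rw [mul_pow]; ring
        _ ≤ _ := by gcongr
  have hper : ∀ (s : ℂ) (t : ℝ), I (s + t * Complex.I) = I s := fun s t => by
    simp only [hI]
    rw [← integral_add_right_eq_self (fun ξ => φ (freq ξ + s • ηC)) ((t / (2 * Real.pi)) • η)]
    congr 1; ext ξ; congr 1; ext j
    simp only [freq, hηC, Pi.add_apply, Pi.smul_apply, smul_eq_mul]
    have : (Real.pi : ℂ) ≠ 0 := by exact_mod_cast Real.pi_ne_zero
    push_cast
    field_simp
    ring
  have hderiv : ∀ s, deriv I s = 0 := fun s => by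
    have h1 : HasDerivAt (fun t : ℝ => s + t * Complex.I) Complex.I 0 := by
      simpa using (((hasDerivAt_id (0 : ℝ)).ofReal_comp).mul_const Complex.I).const_add s
    have h2 : HasDerivAt I (deriv I s) (s + (0 : ℝ) * Complex.I) := by
      simpa using (hdiff s).hasDerivAt
    have h3 := h2.comp (0 : ℝ) h1
    have h4 : (I ∘ fun t : ℝ => s + t * Complex.I) = fun _ => I s := funext fun t => hper s t
    rw [h4] at h3
    simpa using h3.unique (hasDerivAt_const _ _)
  have := is_const_of_deriv_eq_zero hdiff hderiv s 0
  simpa [hI] using this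

/-- The distribution whose Laplace transform is `h` vanishes on every open half-space that
misses `K`. -/
theorem IsPaleyWiener.integral_eq_zero_of_halfSpace (hh : IsPaleyWiener K h) (hK : IsCompact K)
    (hw : IsTest w) (η : Fin n → ℝ) {c c' : ℝ} (hc : c' < c) (hKc : ∀ x ∈ K, ∑ i, x i * η i ≤ c')
    (hwc : ∀ x ∈ tsupport w, c ≤ ∑ i, x i * η i) :
    ∫ ξ, h (freq ξ) * laplace w (freq ξ) = 0 := by
  obtain ⟨C, hC, hb⟩ := hh.mul_laplace_bound hw
  set J := ∫ ξ : Fin n → ℝ, ((1 + ‖ξ‖) ^ (n + 1))⁻¹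
  have key : ∀ t : ℝ, 0 ≤ t → ‖∫ ξ, h (freq ξ) * laplace w (freq ξ)‖ ≤
      C * Real.exp (-((c - c') * t)) * J := fun t ht => by
    rw [← hh.integral_shift_eq hK hw η t, ← integral_const_mul]
    refine norm_integral_le_of_norm_le ((integrable_one_add_norm_pow n).const_mul _)
      (ae_of_all _ fun ξ => ?_)
    have h1 := hb (freq ξ + (t : ℂ) • fun i => (η i : ℂ)) (t * c') (-(t * c))
      (fun x hx => by
        rw [dotC_shift_re, Complex.ofReal_re]
        exact mul_le_mul_of_nonneg_left (hKc x hx) ht)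
      (fun x hx => by
        rw [dotC_shift_re, Complex.ofReal_re]
        exact neg_le_neg (mul_le_mul_of_nonneg_left (hwc x hx) ht))
    rw [← div_eq_mul_inv, le_div_iff₀ (by positivity), mul_comm]
    calc _ ≤ _ := by gcongr; exact norm_le_norm_freq_add ξ η t
      _ ≤ _ := h1
      _ = _ := by congr 2; ring
  have hlim : Tendsto (fun t : ℝ => C * Real.exp (-((c - c') * t)) * J) atTop (𝓝 0) := by
    have : Tendsto (fun t : ℝ => Real.exp (-((c - c') * t))) atTop (𝓝 0) :=
      Real.tendsto_exp_neg_atTop_nhds_zero.comp (tendsto_id.const_mul_atTop (sub_pos.2 hc))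
    simpa using (this.const_mul C).mul_const J
  have := ge_of_tendsto hlim ((eventually_ge_atTop 0).mono key)
  exact norm_le_zero_iff.1 this

open scoped Manifold in
theorem IsPaleyWiener.integral_eq_zero (hh : IsPaleyWiener K h) (hK : IsCompact K)
    (hconv : Convex ℝ K) (hw : IsTest w) (hdisj : Disjoint (tsupport w) K) :
    ∫ ξ, h (freq ξ) * laplace w (freq ξ) = 0 := by
  classical
  have hsep : ∀ x ∈ tsupport w, ∃ (η : Fin n → ℝ) (c : ℝ), c < ∑ i, x i * η i ∧
      ∃ c' < c, ∀ y ∈ K, ∑ i, y i * η i ≤ c' := by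
    intro x hx
    obtain ⟨f, u, hf, hu⟩ := geometric_hahn_banach_closed_point hconv hK.isClosed
      (Set.disjoint_left.1 hdisj hx)
    have hfx : ∀ y, f y = ∑ i, y i * f (Pi.single i 1) := fun y => by
      conv_lhs => rw [← Finset.univ_sum_single y, map_sum]
      refine Finset.sum_congr rfl fun i _ => ?_
      have : (Pi.single i (y i) : Fin n → ℝ) = y i • Pi.single i 1 := by
        rw [← Pi.single_smul, smul_eq_mul, mul_one]
      rw [this, map_smul, smul_eq_mul]
    obtain ⟨c, huc, hc⟩ := exists_between hu
    refine ⟨fun i => f (Pi.single i 1), c, ?_, u, huc, fun y hy => ?_⟩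
    · rwa [← hfx]
    · rw [← hfx]; exact (hf y hy).le
  choose! η c hc c' hc' hKc using hsep
  let U : (Fin n → ℝ) → Set (Fin n → ℝ) := fun x => {y | c x < ∑ i, y i * η x i}
  have hU : ∀ x, IsOpen (U x) := fun x => isOpen_lt continuous_const (by fun_prop)
  obtain ⟨T, hT, hcov⟩ := IsCompact.elim_nhds_subcover hw.2 U
    fun x hx => (hU x).mem_nhds (hc x hx)
  obtain ⟨ρ, hρ⟩ := SmoothPartitionOfUnity.exists_isSubordinate 𝓘(ℝ, Fin n → ℝ)
    (isClosed_tsupport w) (fun x : T => U x) (fun x => hU x) fun x hx => by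
      obtain ⟨y, hy, hxy⟩ := Set.mem_iUnion₂.1 (hcov hx)
      exact Set.mem_iUnion.2 ⟨⟨y, hy⟩, hxy⟩
  have hρc : ∀ i, ContDiff ℝ ∞ fun x => ((ρ i x : ℝ) : ℂ) := fun i =>
    Complex.ofRealCLM.contDiff.comp (ρ i).contMDiff.contDiff
  have htest : ∀ i, IsTest fun x => w x * ((ρ i x : ℝ) : ℂ) := fun i => hw.mul_exp (hρc i)
  have hsum : w = fun x => ∑ i, w x * ((ρ i x : ℝ) : ℂ) := by
    ext x
    by_cases hx : x ∈ tsupport w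
    · have := ρ.sum_eq_one hx
      rw [finsum_eq_sum_of_fintype] at this
      rw [← Finset.mul_sum, ← Complex.ofReal_sum, this, Complex.ofReal_one, mul_one]
    · simp [image_eq_zero_of_notMem_tsupport hx]
  have hlap : ∀ z, laplace w z = ∑ i, laplace (fun x => w x * ((ρ i x : ℝ) : ℂ)) z := fun z => by
    simp only [laplace]
    rw [← integral_finsetSum _ fun i _ => ((htest i).mul_cexp z).integrable]
    congr 1; ext x
    rw [← Finset.sum_mul]
    congr 1
    exact congrFun hsum x
  simp only [hlap, Finset.mul_sum]
  rw [integral_finsetSum _ fun i _ => hh.integrable_mul_laplace (htest i)]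
  refine Finset.sum_eq_zero fun i _ => ?_
  refine hh.integral_eq_zero_of_halfSpace hK (htest i) (η i) (hc' i (hT i i.2)) (hKc i (hT i i.2))
    fun x hx => ?_
  have h1 : x ∈ tsupport (ρ i) := by
    refine closure_mono (fun y hy => ?_) hx
    simp only [Function.mem_support, ne_eq, mul_eq_zero, Complex.ofReal_eq_zero, not_or] at hy
    exact hy.2
  exact (hρ i h1).le

end Shift

/-- The iterated partial derivative along a list of coordinate directions. -/
noncomputable def lpd {n : ℕ} (l : List (Fin n)) (f : (Fin n → ℝ) → ℂ) : (Fin n → ℝ) → ℂ :=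
  l.foldr pd f

section ListDerivative

variable {n : ℕ} {f g w : (Fin n → ℝ) → ℂ}

theorem lpd_cons (i : Fin n) (l : List (Fin n)) (f : (Fin n → ℝ) → ℂ) :
    lpd (i :: l) f = pd i (lpd l f) := rfl

theorem lpd_replicate (k : ℕ) (i : Fin n) (f : (Fin n → ℝ) → ℂ) :
    lpd (List.replicate k i) f = (pd i)^[k] f := by
  induction k with
  | zero => rfl
  | succ k ih => rw [List.replicate_succ, lpd_cons, ih, Function.iterate_succ_apply']

theorem mpd_eq_lpd (α : Fin n →₀ ℕ) (f : (Fin n → ℝ) → ℂ) :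
    mpd α f = lpd ((List.finRange n).flatMap fun i => List.replicate (α i) i) f := by
  rw [lpd, List.foldr_flatMap, mpd]
  congr 1
  ext i g : 2
  exact (lpd_replicate (α i) i g).symm

theorem prod_map_flatMap_replicate (α : Fin n →₀ ℕ) (z : Fin n → ℂ) :
    (((List.finRange n).flatMap fun i => List.replicate (α i) i).map z).prod =
      ∏ i, z i ^ α i := by
  rw [List.map_flatMap, List.flatMap_def, List.prod_flatten, List.map_map, ← List.ofFn_eq_map,
    List.prod_ofFn]
  simp

theorem IsTest.lpd (hw : IsTest w) (l : List (Fin n)) : IsTest (lpd l w) := by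
  induction l with
  | nil => exact hw
  | cons i l ih => exact ih.pd i

theorem laplace_lpd (hw : IsTest w) (l : List (Fin n)) (z : Fin n → ℂ) :
    laplace (lpd l w) z = (l.map z).prod * laplace w z := by
  induction l with
  | nil => simp [lpd]
  | cons i l ih =>
    rw [lpd_cons, laplace_pd (hw.lpd l), ih, List.map_cons, List.prod_cons, mul_assoc]

theorem lpd_congr {x : Fin n → ℝ} (h : f =ᶠ[𝓝 x] g) (l : List (Fin n)) :
    lpd l f =ᶠ[𝓝 x] lpd l g := by
  induction l with
  | nil => exact h
  | cons i l ih =>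
    filter_upwards [ih.fderiv (𝕜 := ℝ)] with y hy
    rw [lpd_cons, lpd_cons, pd, pd, hy]

theorem contDiff_lpd (hf : ContDiff ℝ ∞ f) (l : List (Fin n)) : ContDiff ℝ ∞ (lpd l f) := by
  induction l with
  | nil => exact hf
  | cons i l ih => exact (ih.fderiv_right (m := ∞) (by simp)).clm_apply contDiff_const

theorem lpd_cexp (l : List (Fin n)) (z : Fin n → ℂ) :
    lpd l (fun x => Complex.exp (dotC x z)) =
      fun x => (l.map z).prod * Complex.exp (dotC x z) := by
  induction l with
  | nil => simp [lpd]
  | cons i l ih =>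
    ext x
    rw [lpd_cons, ih, pd, fderiv_const_mul
      ((contDiff_dotC z).cexp.differentiable (by simp) x)]
    have := pd_cexp i z x
    rw [pd] at this
    rw [_root_.smul_apply, this, List.map_cons, List.prod_cons, smul_eq_mul]
    ring

theorem lpd_sub_sum {r : ℕ} (hf : ContDiff ℝ ∞ f) (l : List (Fin n)) (c : Fin r → ℂ)
    {e : Fin r → (Fin n → ℝ) → ℂ} (he : ∀ j, ContDiff ℝ ∞ (e j)) :
    lpd l (fun x => f x - ∑ j, c j * e j x) = fun x => lpd l f x - ∑ j, c j * lpd l (e j) x := by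
  induction l with
  | nil => rfl
  | cons i l ih =>
    ext x
    have h1 : DifferentiableAt ℝ (lpd l f) x := (contDiff_lpd hf l).differentiable (by simp) x
    have h2 : ∀ j, DifferentiableAt ℝ (lpd l (e j)) x := fun j =>
      (contDiff_lpd (he j) l).differentiable (by simp) x
    have h3 : ∀ j ∈ Finset.univ, DifferentiableAt ℝ (fun x => c j * lpd l (e j) x) x :=
      fun j _ => (h2 j).const_mul _
    rw [lpd_cons, ih, pd, fderiv_fun_sub h1 (DifferentiableAt.fun_sum h3), fderiv_fun_sum h3]
    simp only [_root_.sub_apply, _root_.sum_apply, lpd_cons, pd]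
    congr 1
    refine Finset.sum_congr rfl fun j _ => ?_
    rw [fderiv_const_mul (h2 j)]
    rfl

theorem iteratedFDeriv_apply_single (hf : ContDiff ℝ ∞ f) {k : ℕ} (i : Fin k → Fin n)
    (x : Fin n → ℝ) :
    iteratedFDeriv ℝ k f x (fun j => Pi.single (i j) 1) = lpd (List.ofFn i) f x := by
  induction k generalizing x with
  | zero => simp [lpd]
  | succ k ih =>
    have h1 : DifferentiableAt ℝ (iteratedFDeriv ℝ k f) x :=
      (hf.differentiable_iteratedFDeriv (by exact_mod_cast WithTop.coe_lt_top _)) x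
    have h2 : lpd (List.ofFn (Fin.tail i)) f = fun y => iteratedFDeriv ℝ k f y
        (fun j => Pi.single (Fin.tail i j) 1) := funext fun y => (ih _ y).symm
    rw [iteratedFDeriv_succ_apply_left, List.ofFn_succ, lpd_cons, pd]
    change _ = fderiv ℝ (lpd (List.ofFn (Fin.tail i)) f) x _
    rw [h2, fderiv_continuousMultilinear_apply_const_apply h1]
    rfl

theorem norm_iteratedFDeriv_le_sum_lpd (hf : ContDiff ℝ ∞ f) (k : ℕ) (x : Fin n → ℝ) :
    ‖iteratedFDeriv ℝ k f x‖ ≤ ∑ i : Fin k → Fin n, ‖lpd (List.ofFn i) f x‖ := by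
  refine ContinuousMultilinearMap.opNorm_le_bound
    (Finset.sum_nonneg fun i _ => norm_nonneg _) fun v => ?_
  have hv : v = fun j => ∑ i, v j i • (Pi.single i 1 : Fin n → ℝ) := by
    ext j i
    simp [Finset.sum_apply, Pi.single_apply]
  conv_lhs => rw [hv, ContinuousMultilinearMap.map_sum]
  rw [Finset.sum_mul]
  refine (norm_sum_le _ _).trans (Finset.sum_le_sum fun i _ => ?_)
  rw [ContinuousMultilinearMap.map_smul_univ, iteratedFDeriv_apply_single hf, norm_smul, mul_comm,
    norm_prod]
  gcongr with j
  exact norm_le_pi_norm (v j) (i j)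

end ListDerivative

theorem ContinuousMap.exp_apply {X : Type*} [TopologicalSpace X] [CompactSpace X] (g : C(X, ℂ))
    (x : X) : NormedSpace.exp g x = Complex.exp (g x) := by
  have h1 := (NormedSpace.exp_series_hasSum_exp' (𝕂 := ℂ) g).mapL (ContinuousMap.evalCLM ℂ x)
  have h2 := NormedSpace.exp_series_hasSum_exp' (𝕂 := ℂ) (g x)
  rw [Complex.exp_eq_exp_ℂ]
  exact h1.unique h2

theorem Submodule.exists_dual_vanishing {X : Type*} [NormedAddCommGroup X] [NormedSpace ℂ X]
    (S : Submodule ℂ X) {v : X} (hv : v ∉ closure (S : Set X)) :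
    ∃ f : X →L[ℂ] ℂ, (∀ a ∈ S, f a = 0) ∧ f v ≠ 0 := by
  let _ : NormedSpace ℝ X := NormedSpace.restrictScalars ℝ ℂ X
  have : IsScalarTower ℝ ℂ X := RestrictScalars.isScalarTower ℝ ℂ X
  obtain ⟨f, u, hf, hu⟩ := RCLike.geometric_hahn_banach_closed_point (𝕜 := ℂ)
    (s := closure (S : Set X)) (S.restrictScalars ℝ).convex.closure isClosed_closure hv
  have h0 : 0 < u := by simpa using hf 0 (subset_closure S.zero_mem)
  refine ⟨f, fun a ha => ?_, fun h => ?_⟩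
  · by_contra hne
    have := hf (((u : ℂ) / f a) • a) (subset_closure (S.smul_mem _ ha))
    rw [map_smul, smul_eq_mul, div_mul_cancel₀ _ hne] at this
    simp at this
  · rw [h] at hu
    simp at hu
    linarith

section Duality

variable {n : ℕ} {K : Set (Fin n → ℝ)}

/-- The exponential `x ↦ exp(x·z)` as a continuous function on `K`. -/
noncomputable def expOn (K : Set (Fin n → ℝ)) (z : Fin n → ℂ) : C(K, ℂ) where
  toFun x := Complex.exp (dotC (x : Fin n → ℝ) z)
  continuous_toFun := ((contDiff_dotC z).continuous.comp continuous_subtype_val).cexp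

theorem differentiable_expOn [CompactSpace K] : Differentiable ℂ (expOn K) := by
  let coord : Fin n → C(K, ℂ) := fun i => ⟨fun x => ((x : Fin n → ℝ) i : ℂ),
    Complex.continuous_ofReal.comp ((continuous_apply i).comp continuous_subtype_val)⟩
  have h : expOn K = fun z => NormedSpace.exp (∑ i, z i • coord i) := by
    ext z x
    rw [ContinuousMap.exp_apply]
    simp [expOn, coord, dotC, ContinuousMap.sum_apply, mul_comm]
  rw [h]
  refine Differentiable.comp (fun x => (NormedSpace.exp_analytic (𝕂 := ℂ) x).differentiableAt) ?_
  fun_prop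

theorem norm_expOn_le [CompactSpace K] {z : Fin n → ℂ} {b : ℝ}
    (hb : ∀ x ∈ K, (dotC x z).re ≤ b) : ‖expOn K z‖ ≤ Real.exp b := by
  refine (ContinuousMap.norm_le _ (Real.exp_pos b).le).2 fun x => ?_
  change ‖Complex.exp (dotC (x : Fin n → ℝ) z)‖ ≤ _
  rw [Complex.norm_exp]
  exact Real.exp_le_exp.2 (hb x x.2)

theorem expOn_add (z y : Fin n → ℂ) : expOn K (z + y) = expOn K z * expOn K y := by
  ext x
  simp [expOn, dotC_add, Complex.exp_add]

theorem norm_list_prod_le (l : List (Fin n)) (z : Fin n → ℂ) :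
    ‖(l.map z).prod‖ ≤ (1 + ‖z‖) ^ l.length := by
  induction l with
  | nil => simp
  | cons i l ih =>
    rw [List.map_cons, List.prod_cons, List.length_cons, pow_succ', norm_mul]
    gcongr
    linarith [norm_le_pi_norm z i]

theorem differentiable_list_prod (l : List (Fin n)) :
    Differentiable ℂ fun z : Fin n → ℂ => (l.map z).prod := by
  induction l with
  | nil => simp
  | cons i l ih =>
    simp only [List.map_cons, List.prod_cons]
    exact (differentiable_apply i).fun_mul ih

variable {ι : Type*}

/-- The family of partial derivatives, along the lists `L i`, of the exponential with
frequency `z`, restricted to `K`. -/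
noncomputable def expJet (K : Set (Fin n → ℝ)) (L : ι → List (Fin n)) (z : Fin n → ℂ) :
    ι → C(K, ℂ) :=
  fun i => ((L i).map z).prod • expOn K z

theorem differentiable_expJet [CompactSpace K] (L : ι → List (Fin n)) :
    Differentiable ℂ (expJet K L) :=
  differentiable_pi.2 fun i => (differentiable_list_prod (L i)).fun_smul differentiable_expOn

/-- The family of partial derivatives of a test function along the lists `L i`,
restricted to `K`. -/
noncomputable def IsTest.jet {v : (Fin n → ℝ) → ℂ} (hv : IsTest v) (K : Set (Fin n → ℝ))
    (L : ι → List (Fin n)) : ι → C(K, ℂ) :=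
  fun i => ⟨fun x => _root_.lpd (L i) v x, (hv.lpd (L i)).1.continuous.comp continuous_subtype_val⟩

variable [Fintype ι]

theorem norm_expJet_le [CompactSpace K] (L : ι → List (Fin n)) (z : Fin n → ℂ) :
    ‖expJet K L z‖ ≤ (1 + ‖z‖) ^ (∑ i, (L i).length) * ‖expOn K z‖ := by
  refine (pi_norm_le_iff_of_nonneg (by positivity)).2 fun i => ?_
  rw [expJet, norm_smul]
  gcongr
  refine (norm_list_prod_le (L i) z).trans (pow_le_pow_right₀ (by linarith [norm_nonneg z]) ?_)
  exact Finset.single_le_sum (f := fun i => (L i).length) (fun _ _ => Nat.zero_le _)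
    (Finset.mem_univ i)

theorem IsTest.integrable_laplace_smul_expJet [CompactSpace K] {v : (Fin n → ℝ) → ℂ}
    (hv : IsTest v) (L : ι → List (Fin n)) :
    Integrable fun ξ => laplace v (freq ξ) • expJet K L (freq ξ) := by
  obtain ⟨C, hC, h⟩ := laplace_bound ((∑ i, (L i).length) + (n + 1)) hv
  refine ((integrable_one_add_norm_pow n).const_mul C).mono'
    (((continuous_laplace hv).smul (differentiable_expJet L).continuous).comp
      continuous_freq).aestronglyMeasurable (ae_of_all _ fun ξ => ?_)
  have h1 := h (freq ξ) 0 fun x _ => by simp [dotC_freq_re]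
  have h2 := norm_expJet_le (K := K) L (freq ξ)
  have h3 : ‖expOn K (freq ξ)‖ ≤ 1 := by
    simpa using norm_expOn_le (K := K) (z := freq ξ) (b := 0) fun x _ => by simp [dotC_freq_re]
  rw [Real.exp_zero, mul_one, pow_add] at h1
  rw [← div_eq_mul_inv, le_div_iff₀ (by positivity), norm_smul]
  calc _ ≤ ‖laplace v (freq ξ)‖ * ((1 + ‖freq ξ‖) ^ (∑ i, (L i).length) * 1) *
        (1 + ‖freq ξ‖) ^ (n + 1) := by
        have := norm_freq (ξ := ξ)
        gcongr
        exact h2.trans (by gcongr)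
    _ = _ := by ring
    _ ≤ C := h1

theorem IsTest.jet_eq_integral [CompactSpace K] {v : (Fin n → ℝ) → ℂ} (hv : IsTest v)
    (L : ι → List (Fin n)) :
    hv.jet K L = ∫ ξ, laplace v (freq ξ) • expJet K L (freq ξ) := by
  ext i x
  have h := ((ContinuousMap.evalCLM ℂ x).comp (ContinuousLinearMap.proj (R := ℂ)
    (φ := fun _ : ι => C(K, ℂ)) i)).integral_comp_comm (hv.integrable_laplace_smul_expJet (K := K) L)
  refine Eq.trans ?_ h
  refine (laplace_inversion (hv.lpd (L i)) x).symm.trans ?_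
  congr 1; ext ξ
  rw [laplace_lpd hv]
  simp [expJet, expOn]
  ring

end Duality

section Approximation

variable {n : ℕ} {K : Set (Fin n → ℝ)} {A : MvPolynomial (Fin n) ℂ} {v : (Fin n → ℝ) → ℂ}

/-- The constant-coefficient differential operator with symbol `A`. -/
noncomputable def diffOp (A : MvPolynomial (Fin n) ℂ) (f : (Fin n → ℝ) → ℂ) :
    (Fin n → ℝ) → ℂ :=
  fun x => ∑ α ∈ A.support, MvPolynomial.coeff α A * mpd α f x

theorem IsTest.mpd (hv : IsTest v) (α : Fin n →₀ ℕ) : IsTest (mpd α v) := by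
  rw [mpd_eq_lpd]
  exact hv.lpd _

theorem IsTest.diffOp (hv : IsTest v) (A : MvPolynomial (Fin n) ℂ) : IsTest (diffOp A v) :=
  IsTest.sum _ fun α _ => (hv.mpd α).const_mul _

theorem laplace_diffOp (hv : IsTest v) (A : MvPolynomial (Fin n) ℂ) (z : Fin n → ℂ) :
    laplace (diffOp A v) z = MvPolynomial.eval z A * laplace v z := by
  have h : ∀ α, laplace (mpd α v) z = (∏ i, z i ^ α i) * laplace v z := fun α => by
    rw [mpd_eq_lpd, laplace_lpd hv, prod_map_flatMap_replicate]
  calc laplace (diffOp A v) z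
      = ∫ x, ∑ α ∈ A.support, MvPolynomial.coeff α A * (mpd α v x * Complex.exp (-dotC x z)) := by
        simp only [laplace, diffOp, Finset.sum_mul, mul_assoc]
    _ = ∑ α ∈ A.support, MvPolynomial.coeff α A * laplace (mpd α v) z := by
        rw [integral_finsetSum _ fun α _ =>
          (((hv.mpd α).mul_cexp z).const_mul (MvPolynomial.coeff α A)).integrable]
        simp only [integral_const_mul, laplace]
    _ = _ := by
        rw [MvPolynomial.eval_eq', Finset.sum_mul]
        exact Finset.sum_congr rfl fun α _ => by rw [h, mul_assoc]

theorem diffOp_congr {f g : (Fin n → ℝ) → ℂ} {x : Fin n → ℝ} (h : f =ᶠ[𝓝 x] g)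
    (A : MvPolynomial (Fin n) ℂ) : diffOp A f x = diffOp A g x := by
  refine Finset.sum_congr rfl fun α _ => ?_
  rw [mpd_eq_lpd, mpd_eq_lpd, (lpd_congr h _).eq_of_nhds]

/-- A functional on jets over `K` that annihilates the exponentials with frequencies on the
variety of `A` also annihilates the test functions solving the equation near `K`. -/
theorem IsTest.dual_jet_eq_zero [CompactSpace K] (hA : Irreducible A) (hK : Convex ℝ K)
    (hv : IsTest v) (hdisj : Disjoint (tsupport (_root_.diffOp A v)) K) {ι : Type*} [Fintype ι]
    (L : ι → List (Fin n)) (f : (ι → C(K, ℂ)) →L[ℂ] ℂ)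
    (hf : ∀ z, MvPolynomial.eval z A = 0 → f (expJet K L z) = 0) : f (hv.jet K L) = 0 := by
  have hKc : IsCompact K := isCompact_iff_compactSpace.2 ‹_›
  obtain ⟨R, hR⟩ := hKc.isBounded.exists_norm_le
  obtain ⟨θ, C, hdiv⟩ := exists_division hA
  obtain ⟨h, hcont, hline, hfac, hbound⟩ := hdiv (fun z => f (expJet K L z))
    (f.differentiable.comp (differentiable_expJet L)) hf
  set M := ∑ i, (L i).length
  set b₀ := n * (max R 0 * ‖θ‖)
  have hθ : ∀ l : ℂ, ‖l‖ = 1 → ‖expOn K (l • θ)‖ ≤ Real.exp b₀ := fun l hl =>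
    norm_expOn_le fun x hx => by
      refine (Complex.re_le_norm _).trans ((norm_dotC_le x _).trans ?_)
      rw [norm_smul, hl, one_mul]
      change _ ≤ n * (max R 0 * ‖θ‖)
      gcongr
      exact (hR x hx).trans (le_max_left _ _)
  have hexp := (differentiable_expOn (K := K)).continuous
  have hgrow := hbound
    (fun z => ‖f‖ * ((1 + (‖z‖ + ‖θ‖)) ^ M * (‖expOn K z‖ * Real.exp b₀))) (by fun_prop)
    fun z l hl => by
      refine (f.le_opNorm _).trans ?_
      gcongr
      refine (norm_expJet_le L _).trans ?_
      have h1 : ‖z + l • θ‖ ≤ ‖z‖ + ‖θ‖ := by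
        simpa [norm_smul, hl] using norm_add_le z (l • θ)
      rw [expOn_add]
      gcongr
      exact (norm_mul_le _ _).trans (by gcongr; exact hθ l hl)
  have hPW : IsPaleyWiener K h := by
    refine ⟨hcont, hline, M, |C| * ‖f‖ * (1 + ‖θ‖) ^ M * Real.exp b₀, fun z b hb => ?_⟩
    refine (hgrow z).trans ?_
    have h1 : 1 + (‖z‖ + ‖θ‖) ≤ (1 + ‖θ‖) * (1 + ‖z‖) := by
      nlinarith [norm_nonneg z, norm_nonneg θ]
    calc C * (‖f‖ * ((1 + (‖z‖ + ‖θ‖)) ^ M * (‖expOn K z‖ * Real.exp b₀)))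
        ≤ |C| * (‖f‖ * (((1 + ‖θ‖) * (1 + ‖z‖)) ^ M * (Real.exp b * Real.exp b₀))) := by
          gcongr
          · exact le_abs_self C
          · exact norm_expOn_le hb
      _ = _ := by rw [mul_pow]; ring
  rw [hv.jet_eq_integral L, ← f.integral_comp_comm (hv.integrable_laplace_smul_expJet L),
    ← hPW.integral_eq_zero hKc hK (hv.diffOp A) hdisj]
  congr 1; ext ξ
  rw [map_smul, smul_eq_mul, laplace_diffOp hv, hfac]
  ring

/-- Exponential solutions approximate, in finitely many derivatives on a compact convex set, every
test function which solves the equation near that set. -/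
theorem IsTest.exists_exponential_approx (hA : Irreducible A) (hKc : IsCompact K)
    (hK : Convex ℝ K) (hv : IsTest v) (hdisj : Disjoint (tsupport (_root_.diffOp A v)) K)
    {ι : Type*} [Fintype ι] (L : ι → List (Fin n)) {δ : ℝ} (hδ : 0 < δ) :
    ∃ (r : ℕ) (z : Fin r → Fin n → ℂ) (c : Fin r → ℂ), (∀ j, MvPolynomial.eval (z j) A = 0) ∧
      ∀ i, ∀ x ∈ K, ‖_root_.lpd (L i) (fun y => v y - ∑ j, c j * Complex.exp (dotC y (z j))) x‖ ≤ δ := by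
  have : CompactSpace K := isCompact_iff_compactSpace.1 hKc
  let S := Submodule.span ℂ (expJet K L '' {z | MvPolynomial.eval z A = 0})
  have hmem : hv.jet K L ∈ closure (S : Set (ι → C(K, ℂ))) := by
    by_contra hnot
    obtain ⟨f, hf, hne⟩ := S.exists_dual_vanishing hnot
    exact hne (hv.dual_jet_eq_zero hA hK hdisj L f fun z hz =>
      hf _ (Submodule.subset_span ⟨z, hz, rfl⟩))
  obtain ⟨g, hg, hdist⟩ := Metric.mem_closure_iff.1 hmem δ hδ
  obtain ⟨r, c, p, rfl⟩ := Submodule.mem_span_set'.1 hg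
  choose z hz hzp using fun j => (p j).2
  refine ⟨r, z, c, hz, fun i x hx => ?_⟩
  rw [lpd_sub_sum hv.1 (L i) c fun j => (contDiff_dotC (z j)).cexp]
  simp only [lpd_cexp]
  have h1 := (dist_pi_lt_iff hδ).1 hdist i
  have h2 := (ContinuousMap.dist_apply_le_dist (⟨x, hx⟩ : K)).trans h1.le
  rw [dist_eq_norm] at h2
  simpa [IsTest.jet, ← hzp, expJet, expOn, Finset.sum_apply] using h2

open scoped Manifold in
theorem exists_isTest_eventuallyEq {Ω : Set (Fin n → ℝ)} (hΩ : IsOpen Ω) (hKc : IsCompact K)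
    (hK : K ⊆ Ω) {u : (Fin n → ℝ) → ℂ} (hu : ContDiffOn ℝ ∞ u Ω) :
    ∃ v, IsTest v ∧ ∀ᶠ x in 𝓝ˢ K, v x = u x := by
  obtain ⟨K', hK', hKK', hK'Ω⟩ := exists_compact_between hKc hΩ hK
  obtain ⟨χ, h1, h0, -⟩ := exists_contMDiffMap_one_nhds_of_subset_interior (n := ⊤)
    𝓘(ℝ, Fin n → ℝ) hKc.isClosed hKK'
  have hsupp : tsupport χ ⊆ K' := closure_minimal
    (fun x hx => by_contra fun h => hx (h0 x h)) hK'.isClosed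
  have hχ : ContDiff ℝ ∞ fun x => ((χ x : ℝ) : ℂ) :=
    Complex.ofRealCLM.contDiff.comp χ.contMDiff.contDiff
  refine ⟨fun x => χ x * u x, ⟨contDiff_iff_contDiffAt.2 fun x => ?_, ?_⟩, ?_⟩
  · by_cases hx : x ∈ Ω
    · exact hχ.contDiffAt.mul (hu.contDiffAt (hΩ.mem_nhds hx))
    · refine contDiffAt_const (c := (0 : ℂ)) |>.congr_of_eventuallyEq ?_
      filter_upwards [(isClosed_tsupport χ).isOpen_compl.mem_nhds fun h => hx (hK'Ω (hsupp h))]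
        with y hy
      simp [image_eq_zero_of_notMem_tsupport hy]
  · exact HasCompactSupport.intro hK' fun x hx => by simp [h0 x hx]
  · filter_upwards [h1] with x hx
    simp [hx]

end Approximation

theorem IsCompact.convexJoin {E : Type*} [NormedAddCommGroup E] [NormedSpace ℝ E] {s t : Set E}
    (hs : IsCompact s) (ht : IsCompact t) : IsCompact (convexJoin ℝ s t) := by
  have h : _root_.convexJoin ℝ s t = (fun p : ℝ × E × E => (1 - p.1) • p.2.1 + p.1 • p.2.2) ''
      (Set.Icc 0 1 ×ˢ s ×ˢ t) := by
    ext x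
    simp only [mem_convexJoin, segment_eq_image, Set.mem_image, Set.mem_prod, Prod.exists]
    constructor
    · rintro ⟨a, ha, b, hb, θ, hθ, rfl⟩
      exact ⟨θ, a, b, ⟨hθ, ha, hb⟩, rfl⟩
    · rintro ⟨θ, a, b, ⟨hθ, ha, hb⟩, rfl⟩
      exact ⟨a, ha, b, hb, θ, hθ, rfl⟩
  rw [h]
  exact (isCompact_Icc.prod (hs.prod ht)).image (by fun_prop)

theorem IsCompact.exists_convex_between {E : Type*} [NormedAddCommGroup E] [NormedSpace ℝ E]
    [ProperSpace E] {K Ω : Set E} (hK : IsCompact K) (hΩ : IsOpen Ω) (hΩc : Convex ℝ Ω)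
    (hKΩ : K ⊆ Ω) : ∃ H, IsCompact H ∧ Convex ℝ H ∧ K ⊆ H ∧ H ⊆ Ω := by
  refine hK.induction_on (p := fun s => ∃ H, IsCompact H ∧ Convex ℝ H ∧ s ⊆ H ∧ H ⊆ Ω)
    ⟨∅, isCompact_empty, convex_empty, subset_rfl, Set.empty_subset _⟩ ?_ ?_ ?_
  · rintro s t hst ⟨H, h1, h2, h3, h4⟩
    exact ⟨H, h1, h2, hst.trans h3, h4⟩
  · rintro s t ⟨H, h1, h2, h3, h4⟩ ⟨H', h1', h2', h3', h4'⟩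
    rcases H.eq_empty_or_nonempty with rfl | hne
    · exact ⟨H', h1', h2', Set.union_subset (h3.trans (Set.empty_subset _)) h3', h4'⟩
    rcases H'.eq_empty_or_nonempty with rfl | hne'
    · exact ⟨H, h1, h2, Set.union_subset h3 (h3'.trans (Set.empty_subset _)), h4⟩
    refine ⟨_root_.convexJoin ℝ H H', h1.convexJoin h1', h2.convexJoin h2', Set.union_subset
      (h3.trans (subset_convexJoin_left hne')) (h3'.trans (subset_convexJoin_right hne)),
      convexJoin_subset h4 h4' hΩc⟩
  · intro x hx
    obtain ⟨r, hr, hrΩ⟩ := nhds_basis_closedBall.mem_iff.1 (hΩ.mem_nhds (hKΩ hx))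
    exact ⟨closedBall x r, mem_nhdsWithin_of_mem_nhds (closedBall_mem_nhds x hr),
      closedBall x r, isCompact_closedBall x r, convex_closedBall x r, subset_rfl, hrΩ⟩

/-- Ehrenpreis–Palamodov for a single irreducible equation: exponential solutions with
frequencies on the characteristic variety are dense (in the Fréchet `C^∞(Ω)` topology)
in the smooth solutions of `A(∂)u = 0` on an open convex set `Ω`. -/
theorem ehrenpreis_palamodov_irreducible
    (n : ℕ) (hn : 1 ≤ n)
    (A : MvPolynomial (Fin n) ℂ) (hA0 : A ≠ 0) (hAirr : Irreducible A)
    (Ω : Set (Fin n → ℝ)) (hΩopen : IsOpen Ω) (hΩconv : Convex ℝ Ω)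
    (u : (Fin n → ℝ) → ℂ) (hu : ContDiffOn ℝ (⊤ : ℕ∞) u Ω)
    (hsol : ∀ x ∈ Ω, ∑ α ∈ A.support, MvPolynomial.coeff α A * mpd α u x = 0)
    (K : Set (Fin n → ℝ)) (hK : K ⊆ Ω) (hKc : IsCompact K)
    (m : ℕ) (ε : ℝ) (hε : 0 < ε) :
    ∃ (r : ℕ) (z : Fin r → (Fin n → ℂ)) (c : Fin r → ℂ),
      (∀ j, MvPolynomial.eval (z j) A = 0) ∧
      ∀ k ≤ m, ∀ x ∈ K,
        ‖iteratedFDerivWithin ℝ k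
            (fun y => u y - ∑ j, c j * Complex.exp (∑ i, (y i : ℂ) * z j i)) Ω x‖ ≤ ε := by
  obtain ⟨H, hHc, hHconv, hKH, hHΩ⟩ := hKc.exists_convex_between hΩopen hΩconv hK
  obtain ⟨v, hv, huv⟩ := exists_isTest_eventuallyEq hΩopen hHc hHΩ hu
  have hnear : ∀ x ∈ H, v =ᶠ[𝓝 x] u := fun x hx => huv.filter_mono
    (nhds_le_nhdsSet hx)
  have hdisj : Disjoint (tsupport (diffOp A v)) H := by
    refine Set.disjoint_right.2 fun x hx => notMem_tsupport_iff_eventuallyEq.2 ?_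
    filter_upwards [(hnear x hx).eventuallyEq_nhds, hΩopen.mem_nhds (hHΩ hx)] with y hy hyΩ
    exact (diffOp_congr hy A).trans (hsol y hyΩ)
  let N : ℕ := ∑ k : Fin (m + 1), Fintype.card (Fin k → Fin n)
  obtain ⟨r, z, c, hz, happ⟩ := hv.exists_exponential_approx hAirr hHc hHconv hdisj
    (fun i : Σ k : Fin (m + 1), (Fin k → Fin n) => List.ofFn i.2)
    (δ := ε / (N + 1)) (by positivity)
  refine ⟨r, z, c, hz, fun k hk x hx => ?_⟩
  have hxH := hKH hx
  let f : (Fin n → ℝ) → ℂ := fun y => v y - ∑ j, c j * Complex.exp (dotC y (z j))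
  have hf : ContDiff ℝ ∞ f := hv.1.sub (ContDiff.sum fun j _ =>
    contDiff_const.mul (contDiff_dotC (z j)).cexp)
  have hEq : (fun y => u y - ∑ j, c j * Complex.exp (∑ i, (y i : ℂ) * z j i)) =ᶠ[𝓝 x] f := by
    filter_upwards [hnear x hxH] with y hy
    simp only [f, hy, dotC]
  rw [iteratedFDerivWithin_of_isOpen k hΩopen (hK hx), (hEq.iteratedFDeriv ℝ k).eq_of_nhds]
  have hcard : (Fintype.card (Fin k → Fin n) : ℝ) ≤ N := by
    exact_mod_cast Finset.single_le_sum (f := fun k : Fin (m + 1) => Fintype.card (Fin k → Fin n))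
      (fun _ _ => Nat.zero_le _) (Finset.mem_univ (⟨k, Nat.lt_succ_of_le hk⟩ : Fin (m + 1)))
  calc ‖iteratedFDeriv ℝ k f x‖ ≤ ∑ i : Fin k → Fin n, ‖lpd (List.ofFn i) f x‖ :=
        norm_iteratedFDeriv_le_sum_lpd hf k x
    _ ≤ ∑ _i : Fin k → Fin n, ε / (N + 1) :=
        Finset.sum_le_sum fun i _ => happ ⟨⟨k, Nat.lt_succ_of_le hk⟩, i⟩ x hxH
    _ = Fintype.card (Fin k → Fin n) * (ε / (N + 1)) := by simp
    _ ≤ (N + 1) * (ε / (N + 1)) := by gcongr; linarith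
    _ = ε := by field_simp
end

section
/- Let u : ℝ² → ℂ (with coordinates (t,x)) be C^∞ on ℝ² and satisfy the one-dimensional heat equation ∂u/∂t = ∂²u/∂x² at every point (t,x) with x ≥ 0, together with the Dirichlet boundary condition u(t,0) = 0 for all t ∈ ℝ. For ζ ∈ ℂ define b_ζ : ℝ² → ℂ by b_ζ(t,x) = exp(ζ² t + ζ x) − exp(ζ² t − ζ x). Then for every compact set K ⊆ ℝ × [0,∞), every m ∈ ℕ, and every ε > 0, there exist r ∈ ℕ, ζ_1, …, ζ_r ∈ ℂ, and c_1, …, c_r ∈ ℂ such that for every k ≤ m, the k-th iterated derivative of u − Σ_{j=1}^r c_j b_{ζ_j} has norm at most ε at every point of K. -/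
/-- Partial derivative in the first (time) variable. -/
noncomputable def dT (u : ℝ × ℝ → ℂ) : ℝ × ℝ → ℂ :=
  fun p => deriv (fun s => u (s, p.2)) p.1

/-- Partial derivative in the second (space) variable. -/
noncomputable def dX (u : ℝ × ℝ → ℂ) : ℝ × ℝ → ℂ :=
  fun p => deriv (fun s => u (p.1, s)) p.2

/-- B-EPGP basis element for the 1D heat equation with Dirichlet boundary condition. -/
noncomputable def heatDirichletBasis (ζ : ℂ) : ℝ × ℝ → ℂ :=
  fun p => Complex.exp (ζ ^ 2 * (p.1 : ℂ) + ζ * (p.2 : ℂ)) -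
    Complex.exp (ζ ^ 2 * (p.1 : ℂ) - ζ * (p.2 : ℂ))

open Filter Topology Set
open scoped FourierTransform ContDiff

section Series

variable {ι E F : Type*} [NormedAddCommGroup E] [NormedSpace ℝ E] [NormedAddCommGroup F]
  [NormedSpace ℝ F] [CompleteSpace F]

/-- Termwise differentiation, to any order, of a series of smooth functions on a preconnected
open set. -/
theorem iteratedFDeriv_tsum_of_isPreconnected {f : ι → E → F} {s : Set E} (hs : IsOpen s)
    (hs' : IsPreconnected s) (hf : ∀ i, ContDiff ℝ ∞ (f i)) {M : ℕ → ι → ℝ}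
    (hM : ∀ k, Summable (M k))
    (hb : ∀ k i, ∀ x ∈ s, ‖iteratedFDeriv ℝ k (f i) x‖ ≤ M k i) (k : ℕ) :
    ∀ x ∈ s, iteratedFDeriv ℝ k (fun y => ∑' i, f i y) x = ∑' i, iteratedFDeriv ℝ k (f i) x := by
  induction k with
  | zero =>
    intro x hx
    simp only [iteratedFDeriv_zero_eq_comp, Function.comp_apply]
    refine (continuousMultilinearCurryFin0 ℝ E F).symm.toContinuousLinearEquiv.map_tsum
  | succ k ih =>
    intro x hx
    simp only [iteratedFDeriv_succ_eq_comp_left, Function.comp_apply]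
    have h1 : iteratedFDeriv ℝ k (fun y => ∑' i, f i y) =ᶠ[𝓝 x]
        fun y => ∑' i, iteratedFDeriv ℝ k (f i) y := by
      filter_upwards [hs.mem_nhds hx] with y hy using ih y hy
    have h2 : HasFDerivAt (fun y => ∑' i, iteratedFDeriv ℝ k (f i) y)
        (∑' i, fderiv ℝ (iteratedFDeriv ℝ k (f i)) x) x := by
      refine hasFDerivAt_tsum_of_isPreconnected (hM (k + 1)) hs hs'
        (fun i y _ => DifferentiableAt.hasFDerivAt ?_) (fun i y hy => ?_) hx ?_ hx
      · exact ((hf i).differentiable_iteratedFDeriv (by exact_mod_cast ENat.natCast_lt_top k)) y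
      · rw [norm_fderiv_iteratedFDeriv]; exact hb _ i y hy
      · exact .of_norm_bounded (hM k) fun i => hb k i x hx
    rw [h1.fderiv_eq, h2.fderiv]
    exact (continuousMultilinearCurryLeftEquiv ℝ (fun _ : Fin (k + 1) => E)
      F).symm.toContinuousLinearEquiv.map_tsum

/-- A smooth function which is the sum of a series with normally convergent derivatives is
approximated, together with its derivatives, by the partial sums. -/
theorem exists_finset_norm_iteratedFDeriv_sub_sum_le {f : ι → E → F} {s : Set E} (hs : IsOpen s)
    (hs' : IsPreconnected s) (hf : ∀ i, ContDiff ℝ ∞ (f i)) {M : ℕ → ι → ℝ}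
    (hM : ∀ k, Summable (M k))
    (hb : ∀ k i, ∀ x ∈ s, ‖iteratedFDeriv ℝ k (f i) x‖ ≤ M k i)
    {u : E → F} (hu : ContDiff ℝ ∞ u) (hsum : ∀ x ∈ s, HasSum (fun i => f i x) (u x))
    (m : ℕ) {ε : ℝ} (hε : 0 < ε) :
    ∃ A : Finset ι, ∀ k ≤ m, ∀ x ∈ s,
      ‖iteratedFDeriv ℝ k (fun y => u y - ∑ i ∈ A, f i y) x‖ ≤ ε := by
  have key : ∀ k ∈ Finset.range (m + 1), ∀ᶠ A : Finset ι in atTop, ∀ x ∈ s,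
      ‖iteratedFDeriv ℝ k (fun y => u y - ∑ i ∈ A, f i y) x‖ ≤ ε := by
    intro k _
    have := Metric.tendstoUniformlyOn_iff.1 (tendstoUniformlyOn_tsum (hM k) (hb k)) ε hε
    filter_upwards [this] with A hA x hx
    have h1 : u =ᶠ[𝓝 x] fun y => ∑' i, f i y := by
      filter_upwards [hs.mem_nhds hx] with y hy using (hsum y hy).tsum_eq.symm
    have h2 := hA x hx
    rw [← iteratedFDeriv_tsum_of_isPreconnected hs hs' hf hM hb k x hx, dist_eq_norm,
      ← (h1.iteratedFDeriv (𝕜 := ℝ) k).eq_of_nhds] at h2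
    have hk : ((k : ℕ∞) : WithTop ℕ∞) ≤ ∞ := by exact_mod_cast le_top
    have h3 : iteratedFDeriv ℝ k (fun y => u y - ∑ i ∈ A, f i y) x =
        iteratedFDeriv ℝ k u x - ∑ i ∈ A, iteratedFDeriv ℝ k (f i) x := by
      rw [fun_iteratedFDeriv_sub_apply (hu.of_le hk).contDiffAt
        (ContDiff.sum fun i _ => (hf i).of_le hk).contDiffAt,
        iteratedFDeriv_fun_sum_apply fun i _ => ((hf i).of_le hk).contDiffAt]
    rw [h3]
    exact h2.le
  obtain ⟨A, hA⟩ := ((eventually_all_finset _).2 key).exists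
  exact ⟨A, fun k hk => hA k (Finset.mem_range.2 (by omega))⟩

end Series

/-- The Fourier sine series of a continuous function with summable coefficients. -/
theorem hasSum_sine_series {L : ℝ} (hL : 0 < L) {g : ℝ → ℂ} (hg : ContinuousOn g (Icc 0 L))
    (h0 : g 0 = 0) (h1 : g L = 0)
    (hS : Summable fun n : ℤ => ∫ x in (0 : ℝ)..L, g x * Complex.sin (n * Real.pi / L * x))
    {x : ℝ} (hx : x ∈ Icc 0 L) :
    HasSum (fun n : ℤ => 1 / L * (∫ x in (0 : ℝ)..L, g x * Complex.sin (n * Real.pi / L * x)) *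
      Complex.sin (n * Real.pi / L * x)) (g x) := by
  have : Fact (0 < 2 * L) := ⟨by positivity⟩
  let V : ℝ → ℂ := fun y => g (max y 0) - g (max (-y) 0)
  have hV : ContinuousOn V (Icc (-L) L) := by
    refine (hg.comp (by fun_prop) fun y hy => ?_).sub (hg.comp (by fun_prop) fun y hy => ?_)
    · exact ⟨le_max_right _ _, max_le hy.2 hL.le⟩
    · exact ⟨le_max_right _ _, max_le (by linarith [hy.1]) hL.le⟩
  have hVL : V (-L) = V (-L + 2 * L) := by
    have : max (-L) 0 = 0 := max_eq_right (by linarith)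
    simp [V, this, max_eq_left hL.le, h0, h1, show -L + 2 * L = L by ring]
  let G : C(AddCircle (2 * L), ℂ) :=
    ⟨AddCircle.liftIco (2 * L) (-L) V, AddCircle.liftIco_continuous hVL
      (by rwa [show -L + 2 * L = L by ring])⟩
  have hcoeff : ∀ n : ℤ, fourierCoeff G n = -(Complex.I / L) *
      ∫ x in (0 : ℝ)..L, g x * Complex.sin (n * Real.pi / L * x) := by
    intro n
    change fourierCoeff (AddCircle.liftIco (2 * L) (-L) V) n = _
    have hint : ∀ a ∈ Icc (-L) L, ∀ b ∈ Icc (-L) L, IntervalIntegrable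
        (fun y : ℝ => Complex.exp (-(n * Real.pi / L * y * Complex.I)) * V y)
        MeasureTheory.volume a b := fun a ha b hb =>
      (ContinuousOn.mul (by fun_prop) (hV.mono (uIcc_subset_Icc ha hb))).intervalIntegrable
    have hmL : -L ∈ Icc (-L) L := ⟨le_rfl, by linarith⟩
    have hm0 : (0 : ℝ) ∈ Icc (-L) L := ⟨by linarith, hL.le⟩
    have hmR : L ∈ Icc (-L) L := ⟨by linarith, le_rfl⟩
    have h2 : ∫ y in (-L)..(-L + 2 * L), @fourier (2 * L) (-n) y •
          AddCircle.liftIco (2 * L) (-L) V y =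
        ∫ y in (-L)..L, Complex.exp (-(n * Real.pi / L * y * Complex.I)) * V y := by
      rw [show -L + 2 * L = L by ring]
      refine intervalIntegral.integral_congr_Ioo_of_le (by linarith) fun y hy => ?_
      have h3 : AddCircle.liftIco (2 * L) (-L) V y = V y :=
        AddCircle.liftIco_coe_apply (by
          rw [show -L + 2 * L = L by ring]; exact Ioo_subset_Ico_self hy)
      simp only [h3, smul_eq_mul]
      rw [fourier_coe_apply]
      congr 2
      push_cast
      field_simp
    rw [fourierCoeff_eq_intervalIntegral _ _ (-L), h2,
      ← intervalIntegral.integral_add_adjacent_intervals (hint _ hmL _ hm0)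
        (hint _ hm0 _ hmR)]
    have h4 : ∫ y in (-L)..0, Complex.exp (-(n * Real.pi / L * y * Complex.I)) * V y =
        ∫ y in (0 : ℝ)..L, Complex.exp (n * Real.pi / L * y * Complex.I) * V (-y) := by
      have := intervalIntegral.integral_comp_neg (a := 0) (b := L)
        fun y : ℝ => Complex.exp (-(n * Real.pi / L * y * Complex.I)) * V y
      rw [neg_zero] at this
      rw [← this]
      simp
    have hint' : IntervalIntegrable
        (fun y : ℝ => Complex.exp (n * Real.pi / L * y * Complex.I) * V (-y))
        MeasureTheory.volume 0 L := by
      refine ContinuousOn.intervalIntegrable (ContinuousOn.mul (by fun_prop)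
        (hV.comp (by fun_prop) fun y hy => ?_))
      rw [uIcc_of_le hL.le] at hy
      exact ⟨by linarith [hy.2], by linarith [hy.1]⟩
    rw [h4, ← intervalIntegral.integral_add hint' (hint _ hm0 _ hmR),
      ← intervalIntegral.integral_const_mul, ← intervalIntegral.integral_smul]
    refine intervalIntegral.integral_congr fun y hy => ?_
    rw [uIcc_of_le hL.le] at hy
    have hm : max (-y) 0 = 0 := max_eq_right (by linarith [hy.1])
    simp only [V, neg_neg, hm, max_eq_left hy.1, h0, Complex.sin, Complex.real_smul]
    push_cast
    simp only [neg_mul]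
    field_simp
    ring_nf
    simp only [Complex.I_sq]
    ring
  have hG : ∀ y ∈ Ico (-L) L, HasSum (fun n : ℤ => -(Complex.I / L) *
      (∫ x in (0 : ℝ)..L, g x * Complex.sin (n * Real.pi / L * x)) *
      Complex.exp (n * Real.pi / L * y * Complex.I)) (V y) := by
    intro y hy
    have h2 := has_pointwise_sum_fourier_series_of_summable (f := G)
      (by simpa only [funext hcoeff] using hS.mul_left _) (y : AddCircle (2 * L))
    have h3 : G (y : AddCircle (2 * L)) = V y :=
      AddCircle.liftIco_coe_apply (f := V) (by rwa [show -L + 2 * L = L by ring])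
    rw [h3] at h2
    refine h2.congr_fun fun n => ?_
    rw [hcoeff, smul_eq_mul, fourier_coe_apply]
    congr 2
    push_cast
    field_simp
  rcases hx.2.eq_or_lt with rfl | hxL
  · have : ∀ n : ℤ, Complex.sin (n * Real.pi / x * x) = 0 := by
      intro n
      rw [div_mul_cancel₀ _ (by exact_mod_cast hL.ne'), Complex.sin_int_mul_pi]
    simp only [this, mul_zero, h1, hasSum_zero]
  · rcases hx.1.eq_or_lt with rfl | hx0
    · simp [h0, hasSum_zero]
    have h2 := ((hG x ⟨by linarith, hxL⟩).sub (hG (-x) ⟨by linarith, by linarith⟩)).mul_left (1 / 2)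
    have h3 : 1 / 2 * (V x - V (-x)) = g x := by
      have : max (-x) 0 = 0 := max_eq_right (by linarith)
      simp [V, this, max_eq_left hx0.le, h0]
      ring
    rw [h3] at h2
    refine h2.congr_fun fun n => ?_
    rw [Complex.sin]
    push_cast
    simp only [mul_neg, neg_mul]
    field_simp
    ring

theorem summable_inv_one_add_abs_sq : Summable fun n : ℤ => 1 / (1 + |(n : ℝ)|) ^ 2 := by
  refine .of_nonneg_of_le (fun n => by positivity) (fun n => ?_)
    ((Real.summable_one_div_int_add_rpow (1 / 2) 2).2 one_lt_two)
  have h : (n : ℝ) + 1 / 2 ≠ 0 := by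
    intro h
    have : (2 * n + 1 : ℤ) = 0 := by
      have : (2 * n + 1 : ℝ) = 0 := by linarith
      exact_mod_cast this
    omega
  have h' : |(n : ℝ) + 1 / 2| ≤ 1 + |(n : ℝ)| := by
    refine (abs_add_le _ _).trans ?_
    norm_num [abs_of_pos]
    linarith
  rw [show (2 : ℝ) = ((2 : ℕ) : ℝ) by norm_num, Real.rpow_natCast]
  push_cast at h h' ⊢
  gcongr

/-- A smooth function is on a bounded interval the sum of a series of harmonics with nonzero
frequencies and rapidly decreasing coefficients. -/
theorem exists_hasSum_harmonics {h : ℝ → ℂ} (hh : ContDiff ℝ ∞ h) {T : ℝ} (hT : 0 < T) :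
    ∃ c : ℤ → ℂ, (∀ k : ℕ, Summable fun n : ℤ => (1 + |(n : ℝ)|) ^ k * ‖c n‖) ∧
      ∀ t : ℝ, |t| ≤ T → HasSum (fun n : ℤ =>
        c n * Complex.exp (((2 * n + 1) * Real.pi / (4 * T) : ℝ) * Complex.I * t)) (h t) := by
  let χ : ContDiffBump (0 : ℝ) := ⟨1 / 4, 1 / 2, by norm_num, by norm_num⟩
  let f₀ : ℝ → ℂ := fun y => χ y • (h (4 * T * y) * Complex.exp (-(Real.pi * Complex.I * y)))
  have hf₀ : HasCompactSupport f₀ := χ.hasCompactSupport.smul_right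
  have hf₁ : ContDiff ℝ ∞ f₀ := by
    refine χ.contDiff.smul ((hh.comp (by fun_prop)).mul (ContDiff.cexp ?_))
    exact (contDiff_const.mul Complex.ofRealCLM.contDiff).neg
  let f := hf₀.toSchwartzMap hf₁
  have hdecay : ∀ k : ℕ, Summable fun n : ℤ => (1 + |(n : ℝ)|) ^ k * ‖𝓕 f n‖ := by
    intro k
    have hC := fun x : ℝ => SchwartzMap.one_add_le_sup_seminorm_apply (𝕜 := ℝ)
      (m := (k + 2, 0)) le_rfl le_rfl (𝓕 f) x
    refine .of_nonneg_of_le (fun n => by positivity) (fun n => ?_)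
      (summable_inv_one_add_abs_sq.mul_left (2 ^ (k + 2) *
        ((Finset.Iic ((k + 2, 0) : ℕ × ℕ)).sup fun m => SchwartzMap.seminorm ℝ m.1 m.2) (𝓕 f)))
    · have := hC n
      simp only [norm_iteratedFDeriv_zero, Real.norm_eq_abs] at this
      rw [mul_one_div, le_div_iff₀ (by positivity)]
      calc _ = (1 + |(n : ℝ)|) ^ (k + 2) * ‖𝓕 f n‖ := by ring
        _ ≤ _ := this
  refine ⟨fun n => 𝓕 f n, hdecay, fun t ht => ?_⟩
  have hP := f.tsum_eq_tsum_fourier (t / (4 * T))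
  have hy : |t / (4 * T)| ≤ 1 / 4 := by
    rw [abs_div, abs_of_pos (by positivity : 0 < 4 * T), div_le_iff₀ (by positivity)]
    linarith
  rw [tsum_eq_single 0] at hP
  · have hsum : HasSum (fun n : ℤ => 𝓕 f n * fourier n ((t / (4 * T) : ℝ) : UnitAddCircle))
        (f (t / (4 * T) + ((0 : ℤ) : ℝ))) := by
      rw [hP]
      refine (Summable.of_norm ?_).hasSum
      simpa only [norm_mul, fourier_apply, Circle.norm_coe, mul_one, pow_zero, one_mul] using
        hdecay 0
    have hfv : f (t / (4 * T) + ((0 : ℤ) : ℝ)) =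
        h t * Complex.exp (-(Real.pi * Complex.I * (t / (4 * T) : ℝ))) := by
      have : χ (t / (4 * T)) = 1 := χ.one_of_mem_closedBall (by
        rwa [mem_closedBall_zero_iff, Real.norm_eq_abs])
      have h4 : 4 * T * (t / (4 * T)) = t := by field_simp
      simp only [Int.cast_zero, add_zero]
      change f₀ _ = _
      simp only [f₀, this, one_smul, h4]
    have := hsum.mul_left (Complex.exp (Real.pi * Complex.I * (t / (4 * T) : ℝ)))
    rw [hfv, mul_left_comm, ← Complex.exp_add, add_neg_cancel, Complex.exp_zero, mul_one] at this
    refine this.congr_fun fun n => ?_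
    rw [fourier_coe_apply, mul_left_comm, ← Complex.exp_add]
    congr 2
    push_cast
    field_simp
    ring
  · intro n hn
    change f₀ _ = 0
    have : χ (t / (4 * T) + n) = 0 := by
      refine χ.zero_of_le_dist ?_
      change 1 / 2 ≤ _
      rw [dist_zero_right, Real.norm_eq_abs]
      have h1 : (1 : ℝ) ≤ |(n : ℝ)| := by exact_mod_cast Int.one_le_abs hn
      have := abs_sub_abs_le_abs_sub (n : ℝ) (-(t / (4 * T)))
      rw [abs_neg, sub_neg_eq_add, add_comm (n : ℝ)] at this
      linarith
    simp [f₀, this]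

theorem hasDerivAt_dT {u : ℝ × ℝ → ℂ} (hu : Differentiable ℝ u) (t x : ℝ) :
    HasDerivAt (fun s => u (s, x)) (dT u (t, x)) t := by
  have : DifferentiableAt ℝ (fun s => u (s, x)) t := by fun_prop
  exact this.hasDerivAt

theorem hasDerivAt_dX {u : ℝ × ℝ → ℂ} (hu : Differentiable ℝ u) (t x : ℝ) :
    HasDerivAt (fun y => u (t, y)) (dX u (t, x)) x := by
  have : DifferentiableAt ℝ (fun y => u (t, y)) x := by fun_prop
  exact this.hasDerivAt

theorem contDiff_dT {u : ℝ × ℝ → ℂ} (hu : ContDiff ℝ ∞ u) : ContDiff ℝ ∞ (dT u) := by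
  have h : dT u = fun p => fderiv ℝ u p (1, 0) := by
    ext p
    exact ((hu.differentiable (by simp) p).hasFDerivAt.comp_hasDerivAt p.1
      ((hasDerivAt_id p.1).prodMk (hasDerivAt_const p.1 p.2))).deriv
  rw [h]
  exact (hu.fderiv_right le_rfl).clm_apply contDiff_const

theorem contDiff_dX {u : ℝ × ℝ → ℂ} (hu : ContDiff ℝ ∞ u) : ContDiff ℝ ∞ (dX u) := by
  have h : dX u = fun p => fderiv ℝ u p (0, 1) := by
    ext p
    exact ((hu.differentiable (by simp) p).hasFDerivAt.comp_hasDerivAt p.2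
      ((hasDerivAt_const p.2 p.1).prodMk (hasDerivAt_id p.2))).deriv
  rw [h]
  exact (hu.fderiv_right le_rfl).clm_apply contDiff_const

theorem hasDerivAt_sin_const_mul (a : ℂ) (x : ℝ) :
    HasDerivAt (fun y : ℝ => Complex.sin (a * y)) (a * Complex.cos (a * x)) x := by
  have h : HasDerivAt (fun z : ℂ => a * z) (a * 1) (x : ℂ) := (hasDerivAt_id _).const_mul a
  convert! h.csin.comp_ofReal using 1
  ring

theorem hasDerivAt_cos_const_mul (a : ℂ) (x : ℝ) :
    HasDerivAt (fun y : ℝ => Complex.cos (a * y)) (-(a * Complex.sin (a * x))) x := by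
  have h : HasDerivAt (fun z : ℂ => a * z) (a * 1) (x : ℂ) := (hasDerivAt_id _).const_mul a
  convert! h.ccos.comp_ofReal using 1
  ring

/-- Sine coefficients of a second derivative. -/
theorem integral_deriv2_mul_sin {φ φ' φ'' : ℝ → ℂ} (hφ : ∀ x, HasDerivAt φ (φ' x) x)
    (hφ' : ∀ x, HasDerivAt φ' (φ'' x) x) (hc : Continuous φ'') (h0 : φ 0 = 0) {a : ℂ} {L : ℝ}
    (ha : Complex.sin (a * L) = 0) :
    ∫ x in (0 : ℝ)..L, φ'' x * Complex.sin (a * x) =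
      -(a * Complex.cos (a * L) * φ L) - a ^ 2 * ∫ x in (0 : ℝ)..L, φ x * Complex.sin (a * x) := by
  have hcφ : Continuous φ := continuous_iff_continuousAt.2 fun x => (hφ x).continuousAt
  have key := intervalIntegral.integral_eq_sub_of_hasDerivAt (a := 0) (b := L)
    (f := fun x => φ' x * Complex.sin (a * x) - a * (φ x * Complex.cos (a * x)))
    (f' := fun x => φ'' x * Complex.sin (a * x) + a ^ 2 * (φ x * Complex.sin (a * x)))
    (fun x _ => by
      convert! ((hφ' x).mul (hasDerivAt_sin_const_mul a x)).sub
        (((hφ x).mul (hasDerivAt_cos_const_mul a x)).const_mul a) using 1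
      ring)
    ((by fun_prop : Continuous _).intervalIntegrable _ _)
  rw [intervalIntegral.integral_add ((by fun_prop : Continuous _).intervalIntegrable _ _)
    ((by fun_prop : Continuous _).intervalIntegrable _ _),
    intervalIntegral.integral_const_mul] at key
  simp only [ha, h0, Complex.ofReal_zero, mul_zero, Complex.sin_zero, zero_mul] at key
  linear_combination key

/-- The evolution equation of the sine coefficients of a solution of the heat equation. -/
theorem hasDerivAt_sine_coeff {u : ℝ × ℝ → ℂ} (hu : ContDiff ℝ ∞ u)
    (hheat : ∀ t x : ℝ, 0 ≤ x → dT u (t, x) = dX (dX u) (t, x)) (hbc : ∀ t : ℝ, u (t, 0) = 0)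
    {a : ℂ} {L : ℝ} (hL : 0 ≤ L) (ha : Complex.sin (a * L) = 0) (t : ℝ) :
    HasDerivAt (fun s => ∫ x in (0 : ℝ)..L, u (s, x) * Complex.sin (a * x))
      (-(a * Complex.cos (a * L) * u (t, L)) -
        a ^ 2 * ∫ x in (0 : ℝ)..L, u (t, x) * Complex.sin (a * x)) t := by
  have hd := hu.differentiable (by simp)
  have hX := contDiff_dX hu
  have hcu := hu.continuous
  have hcT := (contDiff_dT hu).continuous
  have hcXX := (contDiff_dX hX).continuous
  obtain ⟨C, hC⟩ := ((isCompact_closedBall t 1).prod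
    (isCompact_Icc (a := 0) (b := L))).exists_bound_of_continuousOn
    (f := fun p : ℝ × ℝ => dT u p * Complex.sin (a * p.2)) (by fun_prop)
  have h := (intervalIntegral.hasDerivAt_integral_of_dominated_loc_of_deriv_le (a := 0) (b := L)
    (μ := MeasureTheory.volume) (F := fun s x => u (s, x) * Complex.sin (a * x))
    (F' := fun s x => dT u (s, x) * Complex.sin (a * x)) (x₀ := t) (bound := fun _ => C)
    (Metric.closedBall_mem_nhds t one_pos)
    (.of_forall fun s => (by fun_prop : Continuous _).aestronglyMeasurable)
    ((by fun_prop : Continuous _).intervalIntegrable _ _)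
    (by fun_prop : Continuous _).aestronglyMeasurable
    (.of_forall fun x hx s hs => ?_) intervalIntegrable_const
    (.of_forall fun x _ s _ => (hasDerivAt_dT hd s x).mul_const _)).2
  · convert! h using 1
    rw [← integral_deriv2_mul_sin (hasDerivAt_dX hd t)
      (hasDerivAt_dX (hX.differentiable (by simp)) t) (by fun_prop) (hbc t) ha]
    refine intervalIntegral.integral_congr fun x hx => ?_
    rw [uIcc_of_le hL] at hx
    simp only [hheat t x hx.1]
  · rw [uIoc_of_le hL] at hx
    exact hC (s, x) ⟨hs, hx.1.le, hx.2⟩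

theorem integral_sinh_mul_sin (ζ a : ℂ) {L : ℝ} (ha : Complex.sin (a * L) = 0) :
    ζ ^ 2 * ∫ x in (0 : ℝ)..L,
        (Complex.exp (ζ * x) - Complex.exp (-(ζ * x))) * Complex.sin (a * x) =
      -(a * Complex.cos (a * L) * (Complex.exp (ζ * L) - Complex.exp (-(ζ * L)))) -
        a ^ 2 * ∫ x in (0 : ℝ)..L,
          (Complex.exp (ζ * x) - Complex.exp (-(ζ * x))) * Complex.sin (a * x) := by
  have h1 : ∀ x : ℝ, HasDerivAt (fun y : ℝ => Complex.exp (ζ * y)) (ζ * Complex.exp (ζ * x)) x := by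
    intro x
    have h : HasDerivAt (fun z : ℂ => ζ * z) (ζ * 1) (x : ℂ) := (hasDerivAt_id _).const_mul ζ
    convert! h.cexp.comp_ofReal using 1
    ring
  have h2 : ∀ x : ℝ, HasDerivAt (fun y : ℝ => Complex.exp (-(ζ * y)))
      (-(ζ * Complex.exp (-(ζ * x)))) x := by
    intro x
    have h : HasDerivAt (fun z : ℂ => -(ζ * z)) (-(ζ * 1)) (x : ℂ) :=
      ((hasDerivAt_id _).const_mul ζ).neg
    convert! h.cexp.comp_ofReal using 1
    ring
  rw [← integral_deriv2_mul_sin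
      (φ := fun x => Complex.exp (ζ * x) - Complex.exp (-(ζ * x)))
      (φ' := fun x => ζ * Complex.exp (ζ * x) - -(ζ * Complex.exp (-(ζ * x))))
      (φ'' := fun x => ζ ^ 2 * (Complex.exp (ζ * x) - Complex.exp (-(ζ * x))))
      (fun x => (h1 x).sub (h2 x)) (fun x => ?_)
    (by fun_prop) (by simp) ha, ← intervalIntegral.integral_const_mul]
  · simp only [mul_assoc]
  · convert! ((h1 x).const_mul ζ).sub ((h2 x).const_mul ζ).neg using 1
    ring

theorem contDiff_heatDirichletBasis (ζ : ℂ) : ContDiff ℝ ∞ (heatDirichletBasis ζ) := by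
  have h1 : ContDiff ℝ ∞ fun p : ℝ × ℝ => (p.1 : ℂ) := Complex.ofRealCLM.contDiff.comp contDiff_fst
  have h2 : ContDiff ℝ ∞ fun p : ℝ × ℝ => (p.2 : ℂ) := Complex.ofRealCLM.contDiff.comp contDiff_snd
  unfold heatDirichletBasis
  fun_prop

theorem norm_iteratedFDeriv_cexp_clm_le {E : Type*} [NormedAddCommGroup E] [NormedSpace ℝ E]
    (ℓ : E →L[ℝ] ℂ) (k : ℕ) (p : E) :
    ‖iteratedFDeriv ℝ k (fun q => Complex.exp (ℓ q)) p‖ ≤ ‖ℓ‖ ^ k * ‖Complex.exp (ℓ p)‖ := by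
  have hsm : ContDiff ℝ ∞ fun q => Complex.exp (ℓ q) := by fun_prop
  induction k with
  | zero => simp
  | succ k ih =>
    let m : ℂ →L[ℝ] E →L[ℝ] ℂ :=
      (ContinuousLinearMap.compL ℝ E ℂ ℂ).flip ℓ ∘L ContinuousLinearMap.mul ℝ ℂ
    have hm : ‖m‖ ≤ ‖ℓ‖ := by
      refine ContinuousLinearMap.opNorm_le_bound _ (norm_nonneg _) fun z => ?_
      refine ContinuousLinearMap.opNorm_le_bound _ (by positivity) fun q => ?_
      change ‖z * ℓ q‖ ≤ _
      rw [norm_mul, mul_comm ‖ℓ‖, mul_assoc]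
      gcongr
      exact ℓ.le_opNorm q
    have hf : fderiv ℝ (fun q => Complex.exp (ℓ q)) = m ∘ fun q => Complex.exp (ℓ q) := by
      ext q v
      have := (ℓ.hasFDerivAt (x := q)).cexp.fderiv
      rw [this]
      rfl
    rw [← norm_iteratedFDeriv_fderiv, hf]
    refine (m.norm_iteratedFDeriv_comp_left hsm.contDiffAt (by exact_mod_cast le_top)).trans ?_
    rw [pow_succ', mul_assoc]
    gcongr

theorem norm_iteratedFDeriv_heatDirichletBasis_le (ζ : ℂ) (k : ℕ) {t x : ℝ} (hx : 0 ≤ x) :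
    ‖iteratedFDeriv ℝ k (heatDirichletBasis ζ) (t, x)‖ ≤
      (‖ζ‖ ^ 2 + ‖ζ‖) ^ k * (2 * Real.exp ((ζ ^ 2).re * t + |ζ.re| * x)) := by
  have key : ∀ η : ℂ, ‖η‖ = ‖ζ‖ → |η.re| = |ζ.re| →
      ContDiff ℝ ∞ (fun p : ℝ × ℝ => Complex.exp (ζ ^ 2 * (p.1 : ℂ) + η * (p.2 : ℂ))) ∧
      ‖iteratedFDeriv ℝ k (fun p : ℝ × ℝ => Complex.exp (ζ ^ 2 * (p.1 : ℂ) + η * (p.2 : ℂ)))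
        (t, x)‖ ≤ (‖ζ‖ ^ 2 + ‖ζ‖) ^ k * Real.exp ((ζ ^ 2).re * t + |ζ.re| * x) := by
    intro η hη hη'
    let ℓ : ℝ × ℝ →L[ℝ] ℂ := ζ ^ 2 • (Complex.ofRealCLM ∘L ContinuousLinearMap.fst ℝ ℝ ℝ) +
      η • (Complex.ofRealCLM ∘L ContinuousLinearMap.snd ℝ ℝ ℝ)
    have hℓ : ‖ℓ‖ ≤ ‖ζ‖ ^ 2 + ‖ζ‖ := by
      refine ContinuousLinearMap.opNorm_le_bound _ (by positivity) fun p => ?_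
      refine (norm_add_le (ζ ^ 2 * (p.1 : ℂ)) (η * (p.2 : ℂ))).trans ?_
      rw [norm_mul, norm_mul, norm_pow, hη, add_mul, Complex.norm_real, Complex.norm_real]
      gcongr
      · exact norm_fst_le p
      · exact norm_snd_le p
    refine ⟨(by fun_prop : ContDiff ℝ ∞ fun p => Complex.exp (ℓ p)), ?_⟩
    refine (norm_iteratedFDeriv_cexp_clm_le ℓ k (t, x)).trans ?_
    rw [Complex.norm_exp]
    gcongr
    change (ζ ^ 2 * (t : ℂ) + η * (x : ℂ)).re ≤ _
    rw [Complex.add_re, Complex.re_mul_ofReal, Complex.re_mul_ofReal, ← hη']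
    gcongr
    exact le_abs_self _
  obtain ⟨h1, h1'⟩ := key ζ rfl rfl
  obtain ⟨h2, h2'⟩ := key (-ζ) (norm_neg _) (by rw [Complex.neg_re, abs_neg])
  have hk : ((k : ℕ∞) : WithTop ℕ∞) ≤ ∞ := by exact_mod_cast le_top
  have h : heatDirichletBasis ζ = fun p => Complex.exp (ζ ^ 2 * (p.1 : ℂ) + ζ * (p.2 : ℂ)) -
      Complex.exp (ζ ^ 2 * (p.1 : ℂ) + -ζ * (p.2 : ℂ)) := by
    ext p
    simp only [heatDirichletBasis, neg_mul, sub_eq_add_neg]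
  rw [h, fun_iteratedFDeriv_sub_apply (h1.of_le hk).contDiffAt (h2.of_le hk).contDiffAt]
  refine (norm_sub_le _ _).trans ?_
  linarith

theorem summable_pow_mul_exp_neg_sq {a : ℝ} (ha : 0 < a) {s : ℝ} (hs : 0 < s) (k : ℕ) :
    Summable fun n : ℤ => ((n * a) ^ 2 + |n * a|) ^ k * Real.exp (-((n * a) ^ 2 * s)) := by
  refine .of_nonneg_of_le (fun n => by positivity) (fun n => ?_)
    (summable_inv_one_add_abs_sq.mul_left ((1 + 1 / a) ^ 2 * 2 ^ k * (1 + 1 / s) ^ (k + 2) *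
      ((k + 2).factorial * Real.exp 1)))
  rw [mul_one_div, le_div_iff₀ (by positivity)]
  generalize hb : (n : ℝ) * a = b
  have hn : |(n : ℝ)| = |b| / a := by
    rw [← hb, abs_mul, abs_of_pos ha, mul_div_cancel_right₀ _ ha.ne']
  have hb1 : |b| ≤ 1 + b ^ 2 := by nlinarith [sq_abs b, sq_nonneg (|b| - 1)]
  have h1 : 1 + |(n : ℝ)| ≤ (1 + 1 / a) * (1 + b ^ 2) := by
    have : |b| / a ≤ (1 + b ^ 2) / a := by gcongr
    rw [hn, add_mul, one_mul, div_mul_eq_mul_div, one_mul]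
    nlinarith [sq_nonneg b]
  have h2 : b ^ 2 + |b| ≤ 2 * (1 + b ^ 2) := by linarith [sq_nonneg b]
  have h3 : 1 + b ^ 2 ≤ (1 + 1 / s) * (1 + b ^ 2 * s) := by
    have : (1 + 1 / s) * (1 + b ^ 2 * s) = 1 + b ^ 2 + (1 / s + b ^ 2 * s) := by
      field_simp
      ring
    rw [this]
    have : 0 ≤ 1 / s + b ^ 2 * s := by positivity
    linarith
  have h4 : (1 + b ^ 2 * s) ^ (k + 2) ≤ (k + 2).factorial * Real.exp (1 + b ^ 2 * s) := by
    have := Real.pow_div_factorial_le_exp (1 + b ^ 2 * s) (by positivity) (k + 2)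
    rwa [div_le_iff₀' (by positivity)] at this
  calc (b ^ 2 + |b|) ^ k * Real.exp (-(b ^ 2 * s)) * (1 + |(n : ℝ)|) ^ 2
      ≤ (2 * (1 + b ^ 2)) ^ k * Real.exp (-(b ^ 2 * s)) * ((1 + 1 / a) * (1 + b ^ 2)) ^ 2 := by
        gcongr
    _ = (1 + 1 / a) ^ 2 * 2 ^ k * (1 + b ^ 2) ^ (k + 2) * Real.exp (-(b ^ 2 * s)) := by
        rw [mul_pow, mul_pow]
        ring
    _ ≤ (1 + 1 / a) ^ 2 * 2 ^ k * ((1 + 1 / s) * (1 + b ^ 2 * s)) ^ (k + 2) *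
          Real.exp (-(b ^ 2 * s)) := by gcongr
    _ = (1 + 1 / a) ^ 2 * 2 ^ k * (1 + 1 / s) ^ (k + 2) * (1 + b ^ 2 * s) ^ (k + 2) *
          Real.exp (-(b ^ 2 * s)) := by
        rw [mul_pow]
        ring
    _ ≤ (1 + 1 / a) ^ 2 * 2 ^ k * (1 + 1 / s) ^ (k + 2) *
          ((k + 2).factorial * Real.exp (1 + b ^ 2 * s)) * Real.exp (-(b ^ 2 * s)) := by gcongr
    _ = _ := by
        rw [Real.exp_add, Real.exp_neg]
        have := (Real.exp_pos (b ^ 2 * s)).ne'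
        field_simp

theorem norm_sin_real_mul_le (n : ℤ) (L x : ℝ) : ‖Complex.sin (n * Real.pi / L * x)‖ ≤ 1 := by
  rw [show (n * Real.pi / L * x : ℂ) = ((n * Real.pi / L * x : ℝ) : ℂ) by push_cast; rfl,
    ← Complex.ofReal_sin, Complex.norm_real]
  exact Real.abs_sin_le_one _

/-- On a rectangle, a solution of the heat equation whose values at `x = L` are a sum of harmonics
is the sum of a series of basis functions: time-periodic ones carrying these boundary values, and
decaying sine modes. -/
theorem exists_hasSum_heatDirichletBasis {u : ℝ × ℝ → ℂ} (hu : ContDiff ℝ ∞ u)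
    (hheat : ∀ t x : ℝ, 0 ≤ x → dT u (t, x) = dX (dX u) (t, x)) (hbc : ∀ t : ℝ, u (t, 0) = 0)
    {L T : ℝ} (hL : 0 < L) {c ζ : ℤ → ℂ} {ν : ℤ → ℝ}
    (hζ : ∀ n, ζ n ^ 2 = ν n * Complex.I) (hc : Summable fun n => ‖c n‖) {B : ℝ}
    (hN : ∀ n, Complex.exp (ζ n * L) - Complex.exp (-(ζ n * L)) ≠ 0)
    (hB : ∀ n, ∀ x ∈ Icc 0 L, ‖(Complex.exp (ζ n * x) - Complex.exp (-(ζ n * x))) /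
      (Complex.exp (ζ n * L) - Complex.exp (-(ζ n * L)))‖ ≤ B)
    (hsum : ∀ t, |t| ≤ T → HasSum (fun n => c n * Complex.exp (ν n * Complex.I * t)) (u (t, L))) :
    ∃ (β : ℤ → ℂ) (C : ℝ), (∀ n, ‖β n‖ ≤ C * Real.exp (-((n * Real.pi / L) ^ 2 * T))) ∧
      ∀ t ∈ Ioc (-T) T, ∀ x ∈ Icc 0 L, HasSum (fun n =>
        c n / (Complex.exp (ζ n * L) - Complex.exp (-(ζ n * L))) * heatDirichletBasis (ζ n) (t, x) +
        β n * heatDirichletBasis (n * Real.pi / L * Complex.I) (t, x)) (u (t, x)) := by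
  set N : ℤ → ℂ := fun n => Complex.exp (ζ n * L) - Complex.exp (-(ζ n * L))
  let φ : ℤ → ℝ → ℂ := fun n x => (Complex.exp (ζ n * x) - Complex.exp (-(ζ n * x))) / N n
  have hφc : ∀ n, Continuous (φ n) := fun n => by fun_prop
  let a : ℤ → ℂ := fun n => n * Real.pi / L
  have ha : ∀ n, Complex.sin (a n * L) = 0 := by
    intro n
    rw [div_mul_cancel₀ _ (by exact_mod_cast hL.ne'), Complex.sin_int_mul_pi]
  have hexp : ∀ n (t : ℝ), ‖Complex.exp (ν n * Complex.I * t)‖ = 1 := by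
    intro n t
    rw [show (ν n * Complex.I * t : ℂ) = ((ν n * t : ℝ) : ℂ) * Complex.I by push_cast; ring,
      Complex.norm_exp_ofReal_mul_I]
  have hterm : ∀ k (t : ℝ), ∀ x ∈ Icc 0 L,
      ‖c k * Complex.exp (ν k * Complex.I * t) * φ k x‖ ≤ ‖c k‖ * B := by
    intro k t x hx
    rw [norm_mul, norm_mul, hexp, mul_one]
    exact mul_le_mul_of_nonneg_left (hB k x hx) (norm_nonneg _)
  let w : ℝ → ℝ → ℂ := fun t x => ∑' k, c k * Complex.exp (ν k * Complex.I * t) * φ k x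
  have hw : ∀ (t : ℝ), ∀ x ∈ Icc 0 L,
      HasSum (fun k => c k * Complex.exp (ν k * Complex.I * t) * φ k x) (w t x) := fun t x hx =>
    (Summable.of_norm_bounded (hc.mul_right B) fun k => hterm k t x hx).hasSum
  have hwc : ∀ t, ContinuousOn (w t) (Icc 0 L) := fun t =>
    continuousOn_tsum (fun k => by fun_prop) (hc.mul_right B) fun k x hx => hterm k t x hx
  let J : ℤ → ℤ → ℂ := fun n k => ∫ x in (0 : ℝ)..L, φ k x * Complex.sin (a n * x)
  have hJ : ∀ n k, ‖J n k‖ ≤ B * L := by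
    intro n k
    have := intervalIntegral.norm_integral_le_of_norm_le_const (a := 0) (b := L) (C := B)
      (f := fun x => φ k x * Complex.sin (a n * x)) fun x hx => by
        rw [uIoc_of_le hL.le] at hx
        rw [norm_mul, ← mul_one B]
        have h1 := hB k x ⟨hx.1.le, hx.2⟩
        exact mul_le_mul h1 (norm_sin_real_mul_le n L x) (norm_nonneg _)
          ((norm_nonneg _).trans h1)
    rwa [sub_zero, abs_of_pos hL] at this
  have hJ' : ∀ n k, ν k * Complex.I * J n k = -(a n * Complex.cos (a n * L)) - a n ^ 2 * J n k := by
    intro n k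
    have h := integral_sinh_mul_sin (ζ k) (a n) (ha n)
    have h2 : J n k = (N k)⁻¹ * ∫ x in (0 : ℝ)..L,
        (Complex.exp (ζ k * x) - Complex.exp (-(ζ k * x))) * Complex.sin (a n * x) := by
      rw [← intervalIntegral.integral_const_mul]
      refine intervalIntegral.integral_congr fun x _ => ?_
      simp only [φ, div_eq_mul_inv]
      ring
    have h3 : (N k)⁻¹ * N k = 1 := inv_mul_cancel₀ (hN k)
    change _ = -(a n * Complex.cos (a n * L) * N k) - _ at h
    rw [h2, ← hζ]
    linear_combination (N k)⁻¹ * h - a n * Complex.cos (a n * L) * h3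
  let W : ℤ → ℝ → ℂ := fun n t => ∑' k, c k * Complex.exp (ν k * Complex.I * t) * J n k
  have hWs : ∀ n (t : ℝ),
      HasSum (fun k => c k * Complex.exp (ν k * Complex.I * t) * J n k) (W n t) := by
    intro n t
    refine (Summable.of_norm_bounded (hc.mul_right (B * L)) fun k => ?_).hasSum
    rw [norm_mul, norm_mul, hexp, mul_one]
    exact mul_le_mul_of_nonneg_left (hJ n k) (norm_nonneg _)
  have hW : ∀ n (t : ℝ), |t| ≤ T → HasDerivAt (W n)
      (-(a n * Complex.cos (a n * L) * u (t, L)) - a n ^ 2 * W n t) t := by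
    intro n t ht
    have h := hasDerivAt_tsum
      (g := fun k (s : ℝ) => c k * Complex.exp (ν k * Complex.I * s) * J n k)
      (g' := fun k (s : ℝ) => c k * Complex.exp (ν k * Complex.I * s) *
        (-(a n * Complex.cos (a n * L)) - a n ^ 2 * J n k))
      (u := fun k => ‖c k‖ * (‖a n * Complex.cos (a n * L)‖ + ‖a n ^ 2‖ * (B * L)))
      (hc.mul_right _) (fun k s => ?_) (fun k s => ?_) (hWs n 0).summable t
    · convert! h using 1
      have h2 := ((hsum t ht).mul_left (-(a n * Complex.cos (a n * L)))).sub
        ((hWs n t).mul_left (a n ^ 2))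
      rw [← neg_mul, ← h2.tsum_eq]
      exact tsum_congr fun k => by ring
    · have h1 : HasDerivAt (fun z : ℂ => ν k * Complex.I * z) (ν k * Complex.I * 1) (s : ℂ) :=
        (hasDerivAt_id _).const_mul _
      convert! (h1.cexp.comp_ofReal.const_mul (c k)).mul_const (J n k) using 1
      rw [← hJ']
      ring
    · rw [norm_mul, norm_mul, hexp, mul_one]
      gcongr
      refine (norm_sub_le _ _).trans ?_
      rw [norm_neg, norm_mul (a n ^ 2)]
      gcongr
      exact hJ n k
  let Y : ℤ → ℝ → ℂ := fun n t =>
    (∫ x in (0 : ℝ)..L, u (t, x) * Complex.sin (a n * x)) - W n t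
  have hY : ∀ n (t : ℝ), |t| ≤ T → HasDerivAt (Y n) (-(a n ^ 2 * Y n t)) t := by
    intro n t ht
    convert! (hasDerivAt_sine_coeff hu hheat hbc hL.le (ha n) t).sub (hW n t ht) using 1
    simp only [Y]
    ring
  have hYexp : ∀ n, ∀ t ∈ Icc (-T) T, Y n t = Complex.exp (-(a n ^ 2 * (t + T))) * Y n (-T) := by
    intro n t ht
    have h1 : ∀ s : ℝ, HasDerivAt (fun s : ℝ => Complex.exp (a n ^ 2 * s))
        (Complex.exp (a n ^ 2 * s) * a n ^ 2) s := by
      intro s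
      have h : HasDerivAt (fun z : ℂ => a n ^ 2 * z) (a n ^ 2 * 1) (s : ℂ) :=
        (hasDerivAt_id _).const_mul _
      convert! h.cexp.comp_ofReal using 1
      ring
    have h2 : ∀ s ∈ Icc (-T) T,
        HasDerivAt (fun s : ℝ => Complex.exp (a n ^ 2 * s) * Y n s) 0 s := by
      intro s hs
      convert! (h1 s).mul (hY n s (abs_le.2 hs)) using 1
      ring
    have h3 := constant_of_has_deriv_right_zero
      (fun s hs => (h2 s hs).continuousAt.continuousWithinAt)
      (fun s hs => (h2 s ⟨hs.1, hs.2.le⟩).hasDerivWithinAt) t ht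
    have h4 : Complex.exp (-(a n ^ 2 * t)) * Complex.exp (a n ^ 2 * t) = 1 := by
      rw [← Complex.exp_add, neg_add_cancel, Complex.exp_zero]
    have h5 : Complex.exp (-(a n ^ 2 * (t + T))) =
        Complex.exp (-(a n ^ 2 * t)) * Complex.exp (a n ^ 2 * ((-T : ℝ) : ℂ)) := by
      rw [← Complex.exp_add]
      push_cast
      ring_nf
    rw [h5]
    linear_combination Complex.exp (-(a n ^ 2 * t)) * h3 - Y n t * h4
  have hYint : ∀ n (t : ℝ),
      ∫ x in (0 : ℝ)..L, (u (t, x) - w t x) * Complex.sin (a n * x) = Y n t := by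
    intro n t
    have h1 : HasSum (fun k => ∫ x in (0 : ℝ)..L,
        c k * Complex.exp (ν k * Complex.I * t) * φ k x * Complex.sin (a n * x))
        (∫ x in (0 : ℝ)..L, w t x * Complex.sin (a n * x)) := by
      refine intervalIntegral.hasSum_integral_of_dominated_convergence (fun k _ => ‖c k‖ * B)
        (fun k => (by fun_prop : Continuous _).aestronglyMeasurable)
        (fun k => .of_forall fun x hx => ?_) (.of_forall fun _ _ => hc.mul_right B)
        intervalIntegrable_const (.of_forall fun x hx => ?_) <;> rw [uIoc_of_le hL.le] at hx
      · rw [norm_mul, ← mul_one (‖c k‖ * B)]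
        have h1 := hterm k t x ⟨hx.1.le, hx.2⟩
        exact mul_le_mul h1 (norm_sin_real_mul_le n L x) (norm_nonneg _)
          ((norm_nonneg _).trans h1)
      · exact (hw t x ⟨hx.1.le, hx.2⟩).mul_right _
    have h2 : ∫ x in (0 : ℝ)..L, w t x * Complex.sin (a n * x) = W n t := by
      rw [← h1.tsum_eq]
      refine tsum_congr fun k => ?_
      rw [← intervalIntegral.integral_const_mul]
      simp only [mul_assoc]
    have hcu := hu.continuous
    simp only [sub_mul, Y]
    rw [← h2, intervalIntegral.integral_sub
      ((by fun_prop : Continuous _).intervalIntegrable _ _)]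
    refine ContinuousOn.intervalIntegrable ?_
    rw [uIcc_of_le hL.le]
    exact (hwc t).mul (by fun_prop)
  obtain ⟨C, hC⟩ : ∃ C, ∀ n, ‖Y n (-T)‖ ≤ C := by
    have hcu := hu.continuous
    obtain ⟨C, hC⟩ := (isCompact_Icc (a := 0) (b := L)).exists_bound_of_continuousOn
      (f := fun x => u (-T, x) - w (-T) x) (ContinuousOn.sub (by fun_prop) (hwc _))
    refine ⟨C * L, fun n => ?_⟩
    rw [← hYint]
    have := intervalIntegral.norm_integral_le_of_norm_le_const (a := 0) (b := L) (C := C)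
      (f := fun x => (u (-T, x) - w (-T) x) * Complex.sin (a n * x)) fun x hx => by
        rw [uIoc_of_le hL.le] at hx
        rw [norm_mul, ← mul_one C]
        have h1 := hC x ⟨hx.1.le, hx.2⟩
        exact mul_le_mul h1 (norm_sin_real_mul_le n L x) (norm_nonneg _)
          ((norm_nonneg _).trans h1)
    rwa [sub_zero, abs_of_pos hL] at this
  have hre : ∀ n (s : ℝ), ‖Complex.exp (-(a n ^ 2 * s))‖ =
      Real.exp (-((n * Real.pi / L) ^ 2 * s)) := by
    intro n s
    rw [show -(a n ^ 2 * s) = ((-((n * Real.pi / L) ^ 2 * s) : ℝ) : ℂ) by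
      simp only [a]; push_cast; rfl, Complex.norm_exp_ofReal]
  refine ⟨fun n => Complex.exp (-(a n ^ 2 * T)) * Y n (-T) / (2 * Complex.I * L),
    C / (2 * L), fun n => ?_, fun t ht x hx => ?_⟩
  · rw [norm_div, norm_mul, hre]
    simp only [norm_mul, Complex.norm_I, Complex.norm_real, Complex.norm_ofNat,
      Real.norm_of_nonneg hL.le, mul_one]
    rw [mul_comm, div_mul_eq_mul_div]
    gcongr
    exact hC n
  have hwL : u (t, L) - w t L = 0 := by
    rw [sub_eq_zero]
    refine (hsum t (abs_le.2 ⟨ht.1.le, ht.2⟩)).unique ((hw t L ⟨hL.le, le_rfl⟩).congr_fun ?_)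
    intro k
    simp only [φ]
    rw [div_self (hN k), mul_one]
  have hw0 : u (t, 0) - w t 0 = 0 := by
    simp [hbc, w, φ]
  have hs := hasSum_sine_series hL (g := fun x => u (t, x) - w t x)
    (ContinuousOn.sub (by have := hu.continuous; fun_prop) (hwc t)) hw0 hwL ?_ hx
  · have := (hw t x hx).add hs
    rw [add_sub_cancel] at this
    refine this.congr_fun fun n => ?_
    congr 1
    · simp only [φ, heatDirichletBasis, hζ, sub_eq_add_neg, Complex.exp_add]
      ring
    · rw [show (∫ x in (0 : ℝ)..L, (u (t, x) - w t x) * Complex.sin (n * Real.pi / L * x)) = Y n t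
        from hYint n t, hYexp n t ⟨ht.1.le, ht.2⟩]
      have h1 : (n * Real.pi / L * Complex.I : ℂ) ^ 2 = -(a n ^ 2) := by
        rw [mul_pow, Complex.I_sq]
        ring
      have h2 : (L : ℂ) ≠ 0 := by exact_mod_cast hL.ne'
      have h3 : (n * Real.pi / L * Complex.I * x : ℂ) = a n * x * Complex.I := by
        simp only [a]
        ring
      have h4 : Complex.exp (-(a n ^ 2 * (t + T))) =
          Complex.exp (-(a n ^ 2 * t)) * Complex.exp (-(a n ^ 2 * T)) := by
        rw [← Complex.exp_add]
        ring_nf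
      change _ = 1 / L * _ * Complex.sin (a n * x)
      simp only [heatDirichletBasis, h1, h3, Complex.sin, sub_eq_add_neg, Complex.exp_add,
        neg_mul, h4]
      field_simp
      rw [Complex.I_sq]
      ring
  · simp only [show ∀ n : ℤ, (∫ x in (0 : ℝ)..L, (u (t, x) - w t x) *
      Complex.sin (n * Real.pi / L * x)) = Y n t from fun n => hYint n t]
    refine .of_norm_bounded ((summable_pow_mul_exp_neg_sq (a := Real.pi / L) (by positivity)
      (s := t + T) (by linarith [ht.1]) 0).mul_left C) fun n => ?_
    have := hre n (t + T)
    push_cast at this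
    rw [hYexp n t ⟨ht.1.le, ht.2⟩, norm_mul, this, pow_zero, one_mul, mul_comm, ← mul_div_assoc]
    gcongr
    exact hC n

theorem exists_sq_eq_ofReal_mul_I (ν : ℝ) :
    ∃ ζ : ℂ, ζ ^ 2 = ν * Complex.I ∧ ζ.re = √(|ν| / 2) := by
  have h : (√(|ν| / 2) : ℂ) ^ 2 = (|ν| / 2 : ℝ) := by
    rw [← Complex.ofReal_pow, Real.sq_sqrt (by positivity)]
  obtain hν | hν := le_total 0 ν
  · refine ⟨√(|ν| / 2) * (1 + Complex.I), ?_, by simp⟩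
    rw [mul_pow, h, abs_of_nonneg hν]
    push_cast
    linear_combination (ν / 2 : ℂ) * Complex.I_sq
  · refine ⟨√(|ν| / 2) * (1 - Complex.I), ?_, by simp⟩
    rw [mul_pow, h, abs_of_nonpos hν]
    push_cast
    linear_combination -(ν / 2 : ℂ) * Complex.I_sq

/-- A lower bound for `2 * sinh z` away from the imaginary axis. -/
theorem exp_mul_le_norm_exp_sub_exp_neg {ρ L : ℝ} (hL : 0 ≤ L) {ζ : ℂ} (hζ : ρ ≤ ζ.re) :
    Real.exp (ζ.re * L) * (1 - Real.exp (-(2 * ρ * L))) ≤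
      ‖Complex.exp (ζ * L) - Complex.exp (-(ζ * L))‖ := by
  refine le_trans ?_ (norm_sub_norm_le _ _)
  rw [Complex.norm_exp, Complex.norm_exp, Complex.neg_re, Complex.re_mul_ofReal, mul_sub, mul_one,
    ← Real.exp_add]
  gcongr
  nlinarith

theorem norm_exp_sub_exp_neg_le {ζ : ℂ} (hζ : 0 ≤ ζ.re) {x : ℝ} (hx : 0 ≤ x) :
    ‖Complex.exp (ζ * x) - Complex.exp (-(ζ * x))‖ ≤ 2 * Real.exp (ζ.re * x) := by
  refine (norm_sub_le _ _).trans ?_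
  rw [Complex.norm_exp, Complex.norm_exp, Complex.neg_re, Complex.re_mul_ofReal, two_mul]
  gcongr
  linarith [mul_nonneg hζ hx]

/-- Solutions of the heat equation are approximated by basis functions, uniformly with their
derivatives, on an open rectangle touching the boundary. -/
theorem exists_finset_norm_iteratedFDeriv_sub_heatDirichletBasis_le {u : ℝ × ℝ → ℂ}
    (hu : ContDiff ℝ ∞ u) (hheat : ∀ t x : ℝ, 0 ≤ x → dT u (t, x) = dX (dX u) (t, x))
    (hbc : ∀ t : ℝ, u (t, 0) = 0) {L T : ℝ} (hL : 0 < L) (hT : 0 < T) (m : ℕ) {ε : ℝ}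
    (hε : 0 < ε) :
    ∃ (A : Finset ℤ) (α β ζ η : ℤ → ℂ), ∀ k ≤ m, ∀ p ∈ Ioo (-T + 1) T ×ˢ Ioo 0 L,
      ‖iteratedFDeriv ℝ k (fun q => u q - ∑ n ∈ A, (α n * heatDirichletBasis (ζ n) q +
        β n * heatDirichletBasis (η n) q)) p‖ ≤ ε := by
  obtain ⟨c, hc, hsum⟩ := exists_hasSum_harmonics (h := fun t => u (t, L)) (by fun_prop) hT
  let ν : ℤ → ℝ := fun n => (2 * n + 1) * Real.pi / (4 * T)
  choose ζ hζ hre using fun n => exists_sq_eq_ofReal_mul_I (ν n)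
  let Q := 2 * Real.pi / (4 * T)
  have hQ : 0 < Q := by positivity
  let ρ := √(Q / 4)
  have hρ : 0 < ρ := by positivity
  have hodd : ∀ n : ℤ, 1 ≤ |(2 * n + 1 : ℝ)| := fun n => by
    exact_mod_cast Int.one_le_abs (by omega : 2 * n + 1 ≠ 0)
  have hν : ∀ n, |ν n| = |(2 * n + 1 : ℝ)| * (Q / 2) := by
    intro n
    simp only [ν, Q]
    rw [abs_div, abs_mul, abs_of_pos Real.pi_pos, abs_of_pos (by positivity : 0 < 4 * T)]
    ring
  have hρle : ∀ n, ρ ≤ (ζ n).re := by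
    intro n
    rw [hre, hν]
    refine Real.sqrt_le_sqrt ?_
    nlinarith [hodd n]
  have hζn : ∀ n, ‖ζ n‖ ^ 2 + ‖ζ n‖ ≤ 2 * (1 + Q) * (1 + |(n : ℝ)|) := by
    intro n
    have h1 : ‖ζ n‖ ^ 2 = |ν n| := by
      rw [← norm_pow, hζ, norm_mul, Complex.norm_I, mul_one, Complex.norm_real, Real.norm_eq_abs]
    have h2 : |(2 * n + 1 : ℝ)| ≤ 2 * |(n : ℝ)| + 1 := by
      refine (abs_add_le _ _).trans ?_
      rw [abs_mul, abs_two, abs_one]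
    have h3 : ‖ζ n‖ ≤ 1 + ‖ζ n‖ ^ 2 := by nlinarith [sq_nonneg (‖ζ n‖ - 1)]
    have h4 : ‖ζ n‖ ^ 2 ≤ (2 * |(n : ℝ)| + 1) * (Q / 2) := by
      rw [h1, hν]
      gcongr
    nlinarith [abs_nonneg (n : ℝ), mul_nonneg hQ.le (abs_nonneg (n : ℝ))]
  let δ := 1 - Real.exp (-(2 * ρ * L))
  have hδ : 0 < δ := sub_pos.2 (Real.exp_lt_one_iff.2 (neg_lt_zero.2 (by positivity)))
  let N : ℤ → ℂ := fun n => Complex.exp (ζ n * L) - Complex.exp (-(ζ n * L))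
  have hN : ∀ n, Real.exp ((ζ n).re * L) * δ ≤ ‖N n‖ := fun n =>
    exp_mul_le_norm_exp_sub_exp_neg hL.le (hρle n)
  have hN0 : ∀ n, 0 < ‖N n‖ := fun n => lt_of_lt_of_le (by positivity) (hN n)
  have hre0 : ∀ n, 0 ≤ (ζ n).re := fun n => hρ.le.trans (hρle n)
  have hratio : ∀ n, ∀ x ≤ L, 2 * Real.exp ((ζ n).re * x) / ‖N n‖ ≤ 2 / δ := by
    intro n x hx
    rw [div_le_div_iff₀ (hN0 n) hδ]
    have : Real.exp ((ζ n).re * x) ≤ Real.exp ((ζ n).re * L) :=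
      Real.exp_le_exp.2 (mul_le_mul_of_nonneg_left hx (hre0 n))
    nlinarith [hN n]
  obtain ⟨β, C, hβ, hser⟩ := exists_hasSum_heatDirichletBasis hu hheat hbc hL (c := c) hζ
    (by simpa using hc 0) (B := 2 / δ) (fun n => norm_pos_iff.1 (hN0 n)) (fun n x hx => by
      rw [norm_div]
      refine le_trans ?_ (hratio n x hx.2)
      gcongr
      exact norm_exp_sub_exp_neg_le (hre0 n) hx.1) hsum
  let η : ℤ → ℂ := fun n => n * Real.pi / L * Complex.I
  have hη : ∀ n, η n = ((n * (Real.pi / L) : ℝ) : ℂ) * Complex.I := by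
    intro n
    simp only [η]
    push_cast
    ring
  have hηn : ∀ n, ‖η n‖ = |n * (Real.pi / L)| := by
    intro n
    rw [hη, norm_mul, Complex.norm_I, mul_one, Complex.norm_real, Real.norm_eq_abs]
  have hη2 : ∀ n, (η n ^ 2).re = -(n * (Real.pi / L)) ^ 2 := by
    intro n
    rw [hη, mul_pow, Complex.I_sq, ← Complex.ofReal_pow, mul_neg_one, Complex.neg_re,
      Complex.ofReal_re]
  have hηre : ∀ n, (η n).re = 0 := fun n => by rw [hη]; simp
  have hC : 0 ≤ C := by
    have := (norm_nonneg _).trans (hβ 0)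
    exact nonneg_of_mul_nonneg_left this (Real.exp_pos _)
  let α : ℤ → ℂ := fun n => c n / N n
  have hcd : ∀ (a z : ℂ), ContDiff ℝ ∞ fun q => a * heatDirichletBasis z q := fun a z =>
    contDiff_const.mul (contDiff_heatDirichletBasis z)
  have hsmul : ∀ (a z : ℂ) (k : ℕ) (p : ℝ × ℝ),
      ‖iteratedFDeriv ℝ k (fun q => a * heatDirichletBasis z q) p‖ =
        ‖a‖ * ‖iteratedFDeriv ℝ k (heatDirichletBasis z) p‖ := by
    intro a z k p
    rw [← norm_smul, ← iteratedFDeriv_const_smul_apply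
      ((contDiff_heatDirichletBasis z).of_le (by exact_mod_cast le_top)).contDiffAt]
    rfl
  let M : ℕ → ℤ → ℝ := fun k n =>
    (2 * (1 + Q)) ^ k * (2 / δ) * ((1 + |(n : ℝ)|) ^ k * ‖c n‖) +
      2 * C * (((n * (Real.pi / L)) ^ 2 + |n * (Real.pi / L)|) ^ k *
        Real.exp (-((n * (Real.pi / L)) ^ 2 * 1)))
  have hM : ∀ k, Summable (M k) := fun k => ((hc k).mul_left _).add
    ((summable_pow_mul_exp_neg_sq (by positivity) one_pos k).mul_left _)
  have hb : ∀ k n, ∀ p ∈ Ioo (-T + 1) T ×ˢ Ioo 0 L, ‖iteratedFDeriv ℝ k (fun q =>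
      α n * heatDirichletBasis (ζ n) q + β n * heatDirichletBasis (η n) q) p‖ ≤ M k n := by
    rintro k n ⟨t, x⟩ ⟨ht, hx⟩
    rw [fun_iteratedFDeriv_add_apply
      ((hcd _ _).of_le (by exact_mod_cast le_top)).contDiffAt
      ((hcd _ _).of_le (by exact_mod_cast le_top)).contDiffAt]
    refine (norm_add_le _ _).trans (add_le_add ?_ ?_)
    · rw [hsmul]
      have h1 := norm_iteratedFDeriv_heatDirichletBasis_le (ζ n) k (t := t) hx.1.le
      have h2 : (ζ n ^ 2).re = 0 := by rw [hζ]; simp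
      rw [h2, zero_mul, zero_add, abs_of_nonneg (hre0 n)] at h1
      calc ‖α n‖ * ‖iteratedFDeriv ℝ k (heatDirichletBasis (ζ n)) (t, x)‖
          ≤ ‖α n‖ * ((2 * (1 + Q) * (1 + |(n : ℝ)|)) ^ k * (2 * Real.exp ((ζ n).re * x))) := by
            refine mul_le_mul_of_nonneg_left (h1.trans ?_) (norm_nonneg _)
            gcongr
            exact hζn n
        _ = (2 * (1 + Q)) ^ k * (2 * Real.exp ((ζ n).re * x) / ‖N n‖) *
            ((1 + |(n : ℝ)|) ^ k * ‖c n‖) := by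
            simp only [α]
            rw [norm_div, mul_pow _ (1 + |(n : ℝ)|)]
            ring
        _ ≤ _ := mul_le_mul_of_nonneg_right
            (mul_le_mul_of_nonneg_left (hratio n x hx.2.le) (by positivity)) (by positivity)
    · rw [hsmul]
      have h1 := norm_iteratedFDeriv_heatDirichletBasis_le (η n) k (t := t) hx.1.le
      rw [hη2, hηre, hηn, abs_zero, zero_mul, add_zero, sq_abs] at h1
      have h2 := hβ n
      rw [mul_div_assoc] at h2
      generalize (n : ℝ) * (Real.pi / L) = a at h1 h2 ⊢
      calc ‖β n‖ * ‖iteratedFDeriv ℝ k (heatDirichletBasis (η n)) (t, x)‖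
          ≤ C * Real.exp (-(a ^ 2 * T)) * ((a ^ 2 + |a|) ^ k * (2 * Real.exp (-a ^ 2 * t))) := by
            gcongr
        _ = 2 * C * ((a ^ 2 + |a|) ^ k * Real.exp (-(a ^ 2 * T) + -a ^ 2 * t)) := by
            rw [Real.exp_add]
            ring
        _ ≤ _ := by
            gcongr
            nlinarith [ht.1, sq_nonneg a]
  obtain ⟨A, hA⟩ := exists_finset_norm_iteratedFDeriv_sub_sum_le (isOpen_Ioo.prod isOpen_Ioo)
    ((convex_Ioo _ _).prod (convex_Ioo _ _)).isPreconnected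
    (fun n => (hcd _ _).add (hcd _ _)) hM hb hu
    (fun p hp => hser p.1 ⟨by linarith [hp.1.1], hp.1.2.le⟩ p.2 (Ioo_subset_Icc_self hp.2)) m hε
  exact ⟨A, α, β, ζ, η, hA⟩

/-- The B-EPGP basis `{e^{ζ²t+ζx} − e^{ζ²t−ζx}}` has dense span in the smooth solutions of the
1D heat equation on the halfspace `{x ≥ 0}` with Dirichlet boundary condition at `x = 0`. -/
theorem bepgp_heat1D_dirichlet_dense
    (u : ℝ × ℝ → ℂ) (hu : ContDiff ℝ (⊤ : ℕ∞) u)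
    (hheat : ∀ t x : ℝ, 0 ≤ x → dT u (t, x) = dX (dX u) (t, x))
    (hbc : ∀ t : ℝ, u (t, 0) = 0)
    (K : Set (ℝ × ℝ)) (hKc : IsCompact K) (hK : K ⊆ Set.univ ×ˢ Set.Ici (0 : ℝ))
    (m : ℕ) (ε : ℝ) (hε : 0 < ε) :
    ∃ (r : ℕ) (ζ : Fin r → ℂ) (c : Fin r → ℂ),
      ∀ k ≤ m, ∀ p ∈ K,
        ‖iteratedFDeriv ℝ k (fun q => u q - ∑ j, c j * heatDirichletBasis (ζ j) q) p‖ ≤ ε := by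
  obtain ⟨R, hR0, hR⟩ := hKc.isBounded.exists_pos_norm_le
  obtain ⟨A, α, β, ζ, η, hA⟩ := exists_finset_norm_iteratedFDeriv_sub_heatDirichletBasis_le hu hheat
    hbc (L := R) (T := R + 1) hR0 (by positivity) m hε
  let e := (Fintype.equivFin (A ⊕ A)).symm
  refine ⟨Fintype.card (A ⊕ A), fun j => Sum.elim (fun n : A => ζ n) (fun n => η n) (e j),
    fun j => Sum.elim (fun n : A => α n) (fun n => β n) (e j), fun k hk p hp => ?_⟩
  have heq : ∀ q, ∑ j, Sum.elim (fun n : A => α n) (fun n => β n) (e j) *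
      heatDirichletBasis (Sum.elim (fun n : A => ζ n) (fun n => η n) (e j)) q =
      ∑ n ∈ A, (α n * heatDirichletBasis (ζ n) q + β n * heatDirichletBasis (η n) q) := by
    intro q
    rw [e.sum_comp fun i => Sum.elim (fun n : A => α n) (fun n => β n) i *
      heatDirichletBasis (Sum.elim (fun n : A => ζ n) (fun n => η n) i) q, Fintype.sum_sum_type,
      Finset.sum_add_distrib, ← Finset.sum_coe_sort A, ← Finset.sum_coe_sort A]
    rfl
  simp only [heq]
  have hcd : ContDiff ℝ ∞ fun q => u q - ∑ n ∈ A, (α n * heatDirichletBasis (ζ n) q +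
      β n * heatDirichletBasis (η n) q) :=
    hu.sub (ContDiff.sum fun n _ => (contDiff_const.mul (contDiff_heatDirichletBasis _)).add
      (contDiff_const.mul (contDiff_heatDirichletBasis _)))
  have hclosed : IsClosed {p | ‖iteratedFDeriv ℝ k (fun q => u q - ∑ n ∈ A,
      (α n * heatDirichletBasis (ζ n) q + β n * heatDirichletBasis (η n) q)) p‖ ≤ ε} :=
    isClosed_le (hcd.continuous_iteratedFDeriv (by exact_mod_cast le_top)).norm continuous_const
  refine closure_minimal (fun q hq => hA k hk q hq) hclosed ?_
  rw [closure_prod_eq, closure_Ioo (by linarith), closure_Ioo hR0.ne]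
  have h1 := abs_le.1 ((norm_fst_le p).trans (hR p hp))
  have h2 := abs_le.1 ((norm_snd_le p).trans (hR p hp))
  exact ⟨⟨by linarith, by linarith⟩, (hK hp).2, h2.2⟩
end
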